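/- Let μ be a discrete positive Borel measure on ℝ whose support contains at least two points, let 𝓛 be an algebraic de Branges space with ∫_ℝ |F| dμ < ∞ for all F ∈ 𝓛 and F ↦ F|_ℝ injective from 𝓛 into L¹(μ), and let g₀ ∈ L^∞(μ) with |g₀| = 1 μ-a.e. be such that the closure of {F|_ℝ : F ∈ 𝓛} in L¹(μ) equals {f ∈ L¹(μ) : ∫_ℝ f·g₀ dμ = 0}. Let 𝔪(z) := sup{|F(z)| : F ∈ 𝓛, ‖F|_ℝ‖_{L¹(μ)} ≤ 1}, and define 𝒦 := { F entire : F|_ℝ ∈ L¹(μ), |F(iy)| = O(𝔪(iy)) as |y| → ∞, and there exists F₀ ∈ 𝓛 \ {0} such that F/F₀ is of bounded type on both ℂ⁺ and ℂ⁻ }. Then ‖F‖_𝒦 := ‖F|_ℝ‖_{L¹(μ)} is a norm on 𝒦, 𝒦 is complete with respect to this norm, and for every w ∈ ℂ the point evaluation functional F ↦ F(w) on 𝒦 is continuous with respect to ‖·‖_𝒦. -/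

import Mathlib

open Filter MeasureTheory
open scoped ENNReal NNReal

/-- An algebraic de Branges space: a linear space of entire functions, invariant
under division of zeros and under `F ↦ F^#`. -/
def IsAlgebraicDeBranges (L : Submodule ℂ (ℂ → ℂ)) : Prop :=
  (∀ F ∈ L, Differentiable ℂ F) ∧
  (∀ F ∈ L, ∀ w : ℂ, F w = 0 → ∃ G ∈ L, ∀ z : ℂ, z ≠ w → G z = F z / (z - w)) ∧
  (∀ F ∈ L, (fun z => (starRingEnd ℂ) (F ((starRingEnd ℂ) z))) ∈ L)

/-- The norm of the point evaluation at `z`: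
`𝔪(z) = sup {|F(z)| : F ∈ 𝓛, ‖F|_ℝ‖_{L¹(μ)} ≤ 1}`. -/
noncomputable def L1Majorant (μ : Measure ℝ) (L : Submodule ℂ (ℂ → ℂ)) (z : ℂ) : ℝ≥0∞ :=
  ⨆ F : {F : ℂ → ℂ // F ∈ L ∧ (∫⁻ x : ℝ, (‖F (x : ℂ)‖₊ : ℝ≥0∞) ∂μ) ≤ 1},
    (‖F.1 z‖₊ : ℝ≥0∞)

/-- The open upper half-plane. -/
def UpperHalf : Set ℂ := {z | 0 < z.im}

/-- The open lower half-plane. -/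
def LowerHalf : Set ℂ := {z | z.im < 0}

/-- The (possibly meromorphic) quotient `F/G` is of bounded type on `S`:
`F/G = g₁/g₂` with `g₁, g₂` bounded and holomorphic on `S` and `g₂` not
identically zero; the identity `F/G = g₁/g₂` is expressed as `F·g₂ = G·g₁` on `S`. -/
def BddTypeQuot (S : Set ℂ) (F G : ℂ → ℂ) : Prop :=
  ∃ g₁ g₂ : ℂ → ℂ, DifferentiableOn ℂ g₁ S ∧ DifferentiableOn ℂ g₂ S ∧
    (∃ C : ℝ, ∀ z ∈ S, ‖g₁ z‖ ≤ C) ∧ (∃ C : ℝ, ∀ z ∈ S, ‖g₂ z‖ ≤ C) ∧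
    (¬ ∀ z ∈ S, g₂ z = 0) ∧ (∀ z ∈ S, F z * g₂ z = G z * g₁ z)

/-- `μ` is a discrete measure: it lives on a countable set. -/
def IsDiscreteMeasure (μ : Measure ℝ) : Prop :=
  ∃ s : Set ℝ, s.Countable ∧ μ sᶜ = 0

/-- `x` belongs to the (topological) support of `μ`. -/
def MemSupport (μ : Measure ℝ) (x : ℝ) : Prop :=
  ∀ U ∈ nhds x, μ U ≠ 0

/-- Membership in the space `𝒦`: `F` entire, `F|_ℝ ∈ L¹(μ)`,
`|F(iy)| = O(𝔪(iy))` as `|y| → ∞`, and `F/F₀` of bounded type in both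
half-planes for some `F₀ ∈ 𝓛 \ {0}`. -/
def MemKcal (μ : Measure ℝ) (L : Submodule ℂ (ℂ → ℂ)) (F : ℂ → ℂ) : Prop :=
  Differentiable ℂ F ∧
  (∫⁻ x : ℝ, (‖F (x : ℂ)‖₊ : ℝ≥0∞) ∂μ) < ⊤ ∧
  (∃ C : ℝ≥0, ∀ᶠ (y : ℝ) in (atTop ⊔ atBot : Filter ℝ),
    (‖F ((y : ℂ) * Complex.I)‖₊ : ℝ≥0∞) ≤ C * L1Majorant μ L ((y : ℂ) * Complex.I)) ∧
  ∃ F₀ ∈ L, F₀ ≠ (0 : ℂ → ℂ) ∧ BddTypeQuot UpperHalf F F₀ ∧ BddTypeQuot LowerHalf F F₀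

open Real in
lemma posLog_norm_le_circleAverage {f : ℂ → ℂ} {c : ℂ} {R : ℝ} (hR : 0 < R)
    (hf : AnalyticOnNhd ℂ f (Metric.closedBall c R)) :
    Real.posLog ‖f c‖ ≤ circleAverage (fun z => Real.posLog ‖f z‖) c R := by
  have hci : CircleIntegrable (fun z => Real.posLog ‖f z‖) c R := by
    refine ContinuousOn.circleIntegrable hR.le ?_
    exact Real.continuous_posLog.comp_continuousOn
      (hf.continuousOn.mono Metric.sphere_subset_closedBall).norm
  rcases le_or_gt ‖f c‖ 1 with h1 | h1
  · rw [(Real.posLog_eq_zero_iff _).2 (by simpa using h1)]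
    exact circleAverage_nonneg_of_nonneg (fun z _ => Real.posLog_nonneg)
  have h0 : f c ≠ 0 := by
    intro h
    simp [h] at h1
    linarith
  have habs : |R| = R := abs_of_pos hR
  have hJ := AnalyticOnNhd.circleAverage_log_norm hR.ne' (habs.symm ▸ hf) h0
  have hmer : MeromorphicOn f (Metric.sphere c |R|) := by
    rw [habs]
    exact (hf.mono Metric.sphere_subset_closedBall).meromorphicOn
  have hle : circleAverage (fun z => Real.log ‖f z‖) c R
      ≤ circleAverage (fun z => Real.posLog ‖f z‖) c R := by
    refine circleAverage_mono hmer.circleIntegrable_log_norm hci ?_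
    intro z _
    exact le_max_right _ _
  rw [Real.posLog_eq_log (by simpa using h1.le)]
  refine le_trans ?_ hle
  rw [hJ]
  refine le_add_of_nonneg_left (finsum_nonneg fun u => ?_)
  by_cases hu : u ∈ Metric.closedBall c |R|
  · have hdiv : 0 ≤ MeromorphicOn.divisor f (Metric.closedBall c |R|) u :=
      MeromorphicOn.AnalyticOnNhd.divisor_nonneg (habs.symm ▸ hf) u
    refine mul_nonneg (by exact_mod_cast hdiv) ?_
    rcases eq_or_ne c u with rfl | hne
    · simp
    refine Real.log_nonneg ?_
    have hpos : 0 < ‖c - u‖ := norm_pos_iff.2 (sub_ne_zero.2 hne)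
    rw [← div_eq_mul_inv, one_le_div hpos]
    rw [habs, Metric.mem_closedBall, dist_comm, dist_eq_norm] at hu
    exact hu
  · rw [Function.locallyFinsuppWithin.apply_eq_zero_of_notMem _ hu]
    simp

open Real in
lemma lintegral_circleMap_eq {φ : ℂ → ℝ} {c : ℂ} {ρ : ℝ} (hρ : 0 ≤ ρ)
    (hφ : ContinuousOn φ (Metric.sphere c ρ)) (h0 : ∀ z ∈ Metric.sphere c ρ, 0 ≤ φ z) :
    ∫⁻ θ in Set.Ioo (-π) π, ENNReal.ofReal (φ (circleMap c ρ θ))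
      = ENNReal.ofReal (2 * π * circleAverage φ c ρ) := by
  have hcont : Continuous fun θ => φ (circleMap c ρ θ) :=
    hφ.comp_continuous (continuous_circleMap c ρ) fun θ => circleMap_mem_sphere c hρ θ
  rw [circleAverage_eq_integral_add (-π)]
  rw [intervalIntegral.integral_comp_add_right (fun θ => φ (circleMap c ρ θ))]
  rw [smul_eq_mul, mul_inv_cancel_left₀ (by positivity)]
  rw [intervalIntegral.integral_of_le (by linarith [pi_pos]), integral_Ioc_eq_integral_Ioo]
  have e : (2 * π + -π) = π := by ring
  rw [zero_add, e]
  rw [ofReal_integral_eq_lintegral_ofReal]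
  · exact (hcont.integrableOn_Icc (a := -π) (b := π)).mono_set Set.Ioo_subset_Icc_self
  · exact Eventually.of_forall fun θ => h0 _ (circleMap_mem_sphere c hρ θ)

lemma Complex.polarCoord_symm_eq_circleMap (p : ℝ × ℝ) :
    Complex.polarCoord.symm p = circleMap 0 p.1 p.2 := by
  rw [Complex.polarCoord_symm_apply, circleMap_zero, Complex.exp_mul_I]
  push_cast
  rfl

/-- Polar coordinates for a radially localised integral. -/
lemma lintegral_annulus_eq {a b : ℝ} (ha : 0 ≤ a) {g : ℂ → ℝ≥0∞} (hg : Measurable g) :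
    ∫⁻ z in {z : ℂ | a ≤ ‖z‖ ∧ ‖z‖ < b}, g z
      = ∫⁻ ρ in Set.Ioo a b, ENNReal.ofReal ρ *
          ∫⁻ θ in Set.Ioo (-Real.pi) Real.pi, g (circleMap 0 ρ θ) := by
  have hS : MeasurableSet {z : ℂ | a ≤ ‖z‖ ∧ ‖z‖ < b} :=
    (measurableSet_le measurable_const measurable_norm).inter
      (measurableSet_lt measurable_norm measurable_const)
  rw [← lintegral_indicator hS, ← Complex.lintegral_comp_polarCoord_symm]
  have hm : Measurable fun p : ℝ × ℝ => circleMap 0 p.1 p.2 := by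
    unfold circleMap
    fun_prop
  simp_rw [Complex.polarCoord_symm_eq_circleMap, polarCoord_target, smul_eq_mul]
  rw [Measure.volume_eq_prod, ← Measure.prod_restrict, lintegral_prod]
  swap
  · exact ((measurable_fst.ennreal_ofReal).mul ((hg.indicator hS).comp hm)).aemeasurable
  rw [← lintegral_indicator measurableSet_Ioi,
    ← setLIntegral_congr (Ioo_ae_eq_Ico (a := a) (b := b)).symm,
    ← lintegral_indicator measurableSet_Ico]
  refine lintegral_congr_ae ?_
  have : ∀ᵐ ρ : ℝ, ρ ≠ 0 := by simp [ae_iff]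
  filter_upwards [this] with ρ hρ
  rw [Set.indicator_apply, Set.indicator_apply]
  by_cases h : 0 < ρ
  · rw [if_pos (by exact h)]
    simp_rw [← Function.comp_apply (f := {z : ℂ | a ≤ ‖z‖ ∧ ‖z‖ < b}.indicator g)]
    rw [lintegral_const_mul _ ((hg.indicator hS).comp (continuous_circleMap 0 ρ).measurable)]
    by_cases h2 : ρ ∈ Set.Ico a b
    · rw [if_pos h2]
      congr 1
      refine lintegral_congr fun θ => ?_
      rw [Function.comp_apply, Set.indicator_of_mem]
      simpa [abs_of_pos h] using h2
    · rw [if_neg h2]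
      have : ∀ θ, {z : ℂ | a ≤ ‖z‖ ∧ ‖z‖ < b}.indicator g (circleMap 0 ρ θ) = 0 := by
        intro θ
        rw [Set.indicator_of_notMem]
        simpa [abs_of_pos h] using h2
      simp only [Function.comp_apply, this, lintegral_zero, mul_zero]
  · rw [if_neg (by exact h), if_neg]
    intro h2
    exact h (lt_of_le_of_ne (ha.trans h2.1) (Ne.symm hρ))

open Classical in
lemma ContinuousOn.measurable_indicator {φ : ℂ → ℝ≥0∞} {s : Set ℂ} (hs : MeasurableSet s)
    (hφ : ContinuousOn φ s) : Measurable (s.indicator φ) := by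
  rw [← Set.piecewise_eq_indicator]
  exact ContinuousOn.measurable_piecewise hφ continuousOn_const hs

open Real in
/-- Sub-mean value property of `log⁺ ‖f‖` over discs. -/
lemma posLog_norm_le_lintegral_ball {f : ℂ → ℂ} {c : ℂ} {R : ℝ} (hR : 0 < R)
    (hf : DifferentiableOn ℂ f (Metric.ball c R)) :
    ENNReal.ofReal (π * R ^ 2 * posLog ‖f c‖)
      ≤ ∫⁻ z in Metric.ball c R, ENNReal.ofReal (posLog ‖f z‖) := by
  set g : ℂ → ℂ := fun z => f (c + z) with hg
  have hgd : DifferentiableOn ℂ g (Metric.ball 0 R) := by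
    refine hf.comp (by fun_prop) ?_
    intro z hz
    simpa using hz
  set φ : ℂ → ℝ≥0∞ := (Metric.ball (0 : ℂ) R).indicator
    (fun z => ENNReal.ofReal (posLog ‖g z‖)) with hφ
  have hφm : Measurable φ := by
    refine ContinuousOn.measurable_indicator measurableSet_ball ?_
    exact ENNReal.continuous_ofReal.comp_continuousOn
      (continuous_posLog.comp_continuousOn hgd.continuousOn.norm)
  have hset : {z : ℂ | 0 ≤ ‖z‖ ∧ ‖z‖ < R} = Metric.ball 0 R := by
    ext z
    simp
  have h1 : ∫⁻ z in Metric.ball c R, ENNReal.ofReal (posLog ‖f z‖)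
      = ∫⁻ z in {z : ℂ | 0 ≤ ‖z‖ ∧ ‖z‖ < R}, φ z := by
    rw [hset, hφ, setLIntegral_indicator measurableSet_ball, Set.inter_self,
      ← lintegral_indicator measurableSet_ball, ← lintegral_indicator measurableSet_ball,
      ← lintegral_add_left_eq_self _ c]
    refine lintegral_congr fun z => ?_
    classical
    simp only [Set.indicator_apply, Metric.mem_ball, dist_self_add_left, dist_zero_right, hg]
  rw [h1, lintegral_annulus_eq le_rfl hφm]
  have h2 : ∀ ρ ∈ Set.Ioo 0 R, ENNReal.ofReal ρ * ENNReal.ofReal (2 * π * posLog ‖f c‖)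
      ≤ ENNReal.ofReal ρ * ∫⁻ θ in Set.Ioo (-π) π, φ (circleMap 0 ρ θ) := by
    intro ρ hρ
    gcongr
    have hsub : Metric.closedBall (0 : ℂ) ρ ⊆ Metric.ball 0 R :=
      Metric.closedBall_subset_ball hρ.2
    have h3 : ∀ θ, φ (circleMap 0 ρ θ) = ENNReal.ofReal (posLog ‖g (circleMap 0 ρ θ)‖) := by
      intro θ
      rw [hφ, Set.indicator_of_mem]
      exact hsub (circleMap_mem_closedBall 0 hρ.1.le θ)
    simp_rw [h3]
    rw [lintegral_circleMap_eq (φ := fun z => posLog ‖g z‖) hρ.1.le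
      (continuous_posLog.comp_continuousOn
        (hgd.continuousOn.mono (Metric.sphere_subset_closedBall.trans hsub)).norm)
      (fun z _ => posLog_nonneg)]
    refine ENNReal.ofReal_le_ofReal (mul_le_mul_of_nonneg_left ?_ (by positivity))
    have := posLog_norm_le_circleAverage (f := g) (c := 0) hρ.1
      ((hgd.analyticOnNhd Metric.isOpen_ball).mono hsub)
    simpa [hg] using this
  refine le_trans ?_ (setLIntegral_mono' measurableSet_Ioo h2)
  rw [lintegral_mul_const _ (by fun_prop)]
  have h4 : ∫⁻ ρ in Set.Ioo 0 R, ENNReal.ofReal ρ = ENNReal.ofReal (R ^ 2 / 2) := by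
    rw [← ofReal_integral_eq_lintegral_ofReal]
    · rw [← integral_Ioc_eq_integral_Ioo, ← intervalIntegral.integral_of_le hR.le, integral_id]
      simp
    · exact (continuous_id.integrableOn_Icc (a := 0) (b := R)).mono_set Set.Ioo_subset_Icc_self
    · filter_upwards [ae_restrict_mem measurableSet_Ioo] with ρ hρ using hρ.1.le
  rw [h4, ← ENNReal.ofReal_mul (by positivity)]
  exact ENNReal.ofReal_le_ofReal (le_of_eq (by ring))

open Real in
/-- If `‖f‖ ≤ K` on the unit disc, the nonnegative superharmonic function `log K - log⁺ ‖f‖`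
has small integral over thin annuli. -/
lemma lintegral_annulus_log_sub_posLog_le {f : ℂ → ℂ} {K a : ℝ} (ha : 0 ≤ a)
    (hK : 1 ≤ K) (hf : DifferentiableOn ℂ f (Metric.ball 0 1))
    (hfK : ∀ w ∈ Metric.ball (0 : ℂ) 1, ‖f w‖ ≤ K) :
    ∫⁻ w in {w : ℂ | a ≤ ‖w‖ ∧ ‖w‖ < 1}, ENNReal.ofReal (log K - posLog ‖f w‖)
      ≤ ENNReal.ofReal (2 * π * (1 - a) * (log K - posLog ‖f 0‖)) := by
  have hlogK : posLog K = log K := posLog_eq_log (by rw [abs_of_nonneg] <;> linarith)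
  have hnn : ∀ w ∈ Metric.ball (0 : ℂ) 1, 0 ≤ log K - posLog ‖f w‖ := by
    intro w hw
    rw [← hlogK, sub_nonneg]
    exact posLog_le_posLog (norm_nonneg _) (hfK w hw)
  have hco : ContinuousOn (fun w => log K - posLog ‖f w‖) (Metric.ball 0 1) :=
    continuousOn_const.sub (continuous_posLog.comp_continuousOn hf.continuousOn.norm)
  set φ : ℂ → ℝ≥0∞ := (Metric.ball (0 : ℂ) 1).indicator
    (fun w => ENNReal.ofReal (log K - posLog ‖f w‖)) with hφ
  have hφm : Measurable φ := ContinuousOn.measurable_indicator measurableSet_ball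
    (ENNReal.continuous_ofReal.comp_continuousOn hco)
  have hS : MeasurableSet {z : ℂ | a ≤ ‖z‖ ∧ ‖z‖ < 1} :=
    (measurableSet_le measurable_const measurable_norm).inter
      (measurableSet_lt measurable_norm measurable_const)
  have h1 : ∫⁻ w in {w : ℂ | a ≤ ‖w‖ ∧ ‖w‖ < 1}, ENNReal.ofReal (log K - posLog ‖f w‖)
      = ∫⁻ w in {w : ℂ | a ≤ ‖w‖ ∧ ‖w‖ < 1}, φ w := by
    refine setLIntegral_congr_fun hS fun w hw => ?_
    rw [hφ, Set.indicator_of_mem]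
    simpa using hw.2
  rw [h1, lintegral_annulus_eq ha hφm]
  have h2 : ∀ ρ ∈ Set.Ioo a 1, ENNReal.ofReal ρ * ∫⁻ θ in Set.Ioo (-π) π, φ (circleMap 0 ρ θ)
      ≤ ENNReal.ofReal (2 * π * (log K - posLog ‖f 0‖)) := by
    intro ρ hρ
    have hρ0 : 0 < ρ := ha.trans_lt hρ.1
    have hsub : Metric.closedBall (0 : ℂ) ρ ⊆ Metric.ball 0 1 :=
      Metric.closedBall_subset_ball hρ.2
    have hsub' := Metric.sphere_subset_closedBall.trans hsub
    have h3 : ∀ θ, φ (circleMap 0 ρ θ)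
        = ENNReal.ofReal (log K - posLog ‖f (circleMap 0 ρ θ)‖) := by
      intro θ
      rw [hφ, Set.indicator_of_mem]
      exact hsub (circleMap_mem_closedBall 0 hρ0.le θ)
    simp_rw [h3]
    rw [lintegral_circleMap_eq (φ := fun z => log K - posLog ‖f z‖) hρ0.le
      (hco.mono hsub') (fun z hz => hnn z (hsub' hz))]
    refine (mul_le_mul_left (ENNReal.ofReal_le_one.2 hρ.2.le) _).trans ?_
    rw [one_mul]
    refine ENNReal.ofReal_le_ofReal (mul_le_mul_of_nonneg_left ?_ (by positivity))
    have h5 := posLog_norm_le_circleAverage (f := f) (c := 0) hρ0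
      ((hf.analyticOnNhd Metric.isOpen_ball).mono hsub)
    rw [circleAverage_fun_sub (f₂ := fun z => posLog ‖f z‖) (circleIntegrable_const _ _ _)
      (ContinuousOn.circleIntegrable hρ0.le (continuous_posLog.comp_continuousOn
        (hf.continuousOn.mono hsub').norm)), circleAverage_const]
    linarith
  refine (setLIntegral_mono' measurableSet_Ioo h2).trans ?_
  rw [setLIntegral_const, Real.volume_Ioo, ← ENNReal.ofReal_mul
    (mul_nonneg (by positivity) (hnn 0 (by simp)))]
  exact ENNReal.ofReal_le_ofReal (le_of_eq (by ring))

lemma Complex.det_restrictScalars_toSpanSingleton (d : ℂ) :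
    ((ContinuousLinearMap.toSpanSingleton ℂ d).restrictScalars ℝ).det = ‖d‖ ^ 2 := by
  simp [ContinuousLinearMap.det, LinearMap.det_restrictScalars,
      Algebra.norm_complex_eq, Complex.normSq_eq_norm_sq]

lemma neg_log_max_eq {x δ : ℝ} (hx : 0 ≤ x) (hδ : 0 < δ) :
    Real.log (1 / δ) - Real.posLog (x / δ) = -Real.log (max x δ) := by
  rw [Real.posLog_eq_log_max_one (by positivity), Real.log_div one_ne_zero hδ.ne', Real.log_one]
  have : max 1 (x / δ) = max x δ / δ := by
    rw [← max_div_div_right hδ.le, div_self hδ.ne', max_comm]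
  rw [this, Real.log_div (by positivity) hδ.ne']
  ring

open ComplexConjugate in
lemma lintegral_halfPlane_neg_log_le {c : ℂ} (hc : c ≠ 0) {R δ : ℝ} (hR : 8 * ‖c‖ ≤ R)
    (hδ : 0 < δ) (hδ1 : δ ≤ 1) {D : ℂ → ℂ}
    (hD : DifferentiableOn ℂ D {z | 0 < (z * conj c).re})
    (hD1 : ∀ z, 0 < (z * conj c).re → ‖D z‖ ≤ 1) :
    ∫⁻ z in {z : ℂ | 0 < (z * conj c).re ∧ R / 2 < ‖z‖ ∧ ‖z‖ < 3 * R / 2},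
        ENNReal.ofReal (-Real.log (max ‖D z‖ δ))
      ≤ ENNReal.ofReal (64 * Real.pi * R ^ 3 / ‖c‖ * -Real.log (max ‖D c‖ δ)) := by
  have hc0 : 0 < ‖c‖ := norm_pos_iff.2 hc
  have hR0 : 0 < R := by linarith
  set S : Set ℂ := {z : ℂ | 0 < (z * conj c).re ∧ R / 2 < ‖z‖ ∧ ‖z‖ < 3 * R / 2} with hS
  set ψ : ℂ → ℂ := fun w => c * (1 + w) / (1 - w) with hψ
  have hne : ∀ w ∈ Metric.ball (0 : ℂ) 1, (1 - w) ≠ 0 := by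
    intro w hw h
    rw [sub_eq_zero] at h
    simp [← h] at hw
  have hψd : ∀ w ∈ Metric.ball (0 : ℂ) 1, HasDerivAt ψ (2 * c / (1 - w) ^ 2) w := by
    intro w hw
    have h1 : HasDerivAt (fun w : ℂ => c * (1 + w)) c w := by
      simpa using ((hasDerivAt_id w).const_add 1).const_mul c
    have h2 : HasDerivAt (fun w : ℂ => 1 - w) (-1) w := by
      simpa using (hasDerivAt_id w).const_sub 1
    have h3 := h1.div h2 (hne w hw)
    have h4 : c * (1 - w) - c * (1 + w) * -1 = 2 * c := by ring
    rwa [h4] at h3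
  have hψH : ∀ w ∈ Metric.ball (0 : ℂ) 1, 0 < (ψ w * conj c).re := by
    intro w hw
    have h1 : ψ w * conj c = ((‖c‖ ^ 2 / ‖1 - w‖ ^ 2 : ℝ) : ℂ) * ((1 + w) * conj (1 - w)) := by
      have h3 := hne w hw
      have h4 : conj (1 - w) ≠ 0 := (map_ne_zero _).2 h3
      push_cast
      rw [← Complex.mul_conj', ← Complex.mul_conj']
      simp only [hψ]
      field_simp
    rw [h1, Complex.re_ofReal_mul]
    have h3 : 0 < ‖1 - w‖ := norm_pos_iff.2 (hne w hw)
    refine mul_pos (by positivity) ?_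
    have h5 : ((1 + w) * conj (1 - w)).re = 1 - ‖w‖ ^ 2 := by
      rw [← Complex.normSq_eq_norm_sq, Complex.normSq_apply]
      simp
      ring
    rw [h5]
    have : ‖w‖ < 1 := by simpa using hw
    nlinarith [norm_nonneg w]
  have hψinj : Set.InjOn ψ (Metric.ball (0 : ℂ) 1) := by
    intro w hw w' hw' h
    simp only [hψ] at h
    rw [div_eq_div_iff (hne w hw) (hne w' hw')] at h
    have : 2 * c * (w - w') = 0 := by linear_combination h
    simpa [hc, sub_eq_zero] using this
  have hψc : ContinuousOn ψ (Metric.ball (0 : ℂ) 1) :=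
    fun w hw => (hψd w hw).continuousAt.continuousWithinAt
  have hSo : IsOpen S := by
    refine IsOpen.and ?_ (IsOpen.and ?_ ?_)
    · exact isOpen_lt continuous_const (by fun_prop)
    · exact isOpen_lt continuous_const (by fun_prop)
    · exact isOpen_lt (by fun_prop) continuous_const
  set T : Set ℂ := Metric.ball (0 : ℂ) 1 ∩ ψ ⁻¹' S with hT
  have hTo : IsOpen T := hψc.isOpen_inter_preimage Metric.isOpen_ball hSo
  have key : ∀ z : ℂ, 0 < (z * conj c).re → ‖z‖ ^ 2 ≤ ‖z + c‖ ^ 2 ∧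
      ‖z + c‖ ^ 2 - ‖z - c‖ ^ 2 = 4 * (z * conj c).re := by
    intro z hz
    simp only [← Complex.normSq_eq_norm_sq, Complex.normSq_add, Complex.normSq_sub]
    refine ⟨?_, by ring⟩
    nlinarith [Complex.normSq_nonneg c]
  have hinv : ∀ z ∈ S, z + c ≠ 0 ∧ (z - c) / (z + c) ∈ Metric.ball (0 : ℂ) 1 ∧
      ψ ((z - c) / (z + c)) = z := by
    intro z hz
    obtain ⟨k1, k2⟩ := key z hz.1
    have hzpos : 0 < ‖z‖ := by linarith [hz.2.1]
    have hpos : 0 < ‖z + c‖ := by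
      by_contra h
      have : ‖z + c‖ = 0 := le_antisymm (not_lt.1 h) (norm_nonneg _)
      rw [this] at k1
      nlinarith
    have hzc : z + c ≠ 0 := norm_pos_iff.1 hpos
    refine ⟨hzc, ?_, ?_⟩
    · rw [mem_ball_zero_iff, norm_div, div_lt_one hpos]
      have := hz.1
      nlinarith [norm_nonneg (z - c)]
    · simp only [hψ]
      have h1 : 1 + (z - c) / (z + c) = 2 * z / (z + c) := by field_simp; ring
      have h2 : 1 - (z - c) / (z + c) = 2 * c / (z + c) := by field_simp; ring
      rw [h1, h2]
      field_simp
  have himg : ψ '' T = S := by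
    ext z
    constructor
    · rintro ⟨w, hw, rfl⟩
      exact hw.2
    · intro hz
      obtain ⟨-, h2, h3⟩ := hinv z hz
      refine ⟨_, ⟨h2, ?_⟩, h3⟩
      rw [Set.mem_preimage, h3]
      exact hz
  have hTw : ∀ w ∈ T, w = (ψ w - c) / (ψ w + c) := by
    intro w hw
    obtain ⟨-, h2, h3⟩ := hinv (ψ w) hw.2
    exact (hψinj h2 hw.1 h3).symm
  have hTa : T ⊆ {w : ℂ | 1 - 8 * ‖c‖ / R ≤ ‖w‖ ∧ ‖w‖ < 1} := by
    intro w hw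
    have hw1 : ‖w‖ < 1 := by simpa using hw.1
    refine ⟨?_, hw1⟩
    obtain ⟨k1, k2⟩ := key (ψ w) hw.2.1
    have hne' := (hinv (ψ w) hw.2).1
    have hp : 0 < ‖ψ w + c‖ := norm_pos_iff.2 hne'
    have h1 : ‖w‖ * ‖ψ w + c‖ = ‖ψ w - c‖ := by
      rw [← norm_mul, (eq_div_iff hne').1 (hTw w hw)]
    have h2 : (ψ w * conj c).re ≤ ‖ψ w‖ * ‖c‖ := by
      have := Complex.re_le_norm (ψ w * conj c)
      rwa [norm_mul, Complex.norm_conj] at this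
    have hz : R / 2 < ‖ψ w‖ := hw.2.2.1
    set x := ‖ψ w‖
    set y := ‖ψ w + c‖
    have h3 : (1 - ‖w‖ ^ 2) * y ^ 2 ≤ 4 * x * ‖c‖ := by
      have : (1 - ‖w‖ ^ 2) * y ^ 2 = 4 * (ψ w * conj c).re := by rw [← k2, ← h1]; ring
      rw [this]; linarith
    have hw0 := norm_nonneg w
    have h4 : (1 - ‖w‖) * x ^ 2 ≤ 4 * x * ‖c‖ := by
      refine le_trans ?_ h3
      refine mul_le_mul ?_ k1 (sq_nonneg _) ?_ <;> nlinarith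
    have hx : 0 < x := by linarith
    have h5 : (1 - ‖w‖) * x ≤ 4 * ‖c‖ := by
      refine le_of_mul_le_mul_right (a := x) ?_ hx
      nlinarith
    have h6 : (1 - ‖w‖) * R ≤ 8 * ‖c‖ := by nlinarith
    rw [sub_le_comm, le_div_iff₀ hR0]
    exact h6
  have hder : ∀ w ∈ T, ‖2 * c / (1 - w) ^ 2‖ ^ 2 ≤ 4 * R ^ 4 / ‖c‖ ^ 2 := by
    intro w hw
    have hne' := (hinv (ψ w) hw.2).1
    have h1 : 1 - w = 2 * c / (ψ w + c) := by
      rw [eq_div_iff hne']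
      linear_combination -(eq_div_iff hne').1 (hTw w hw)
    have h2 : 2 * c / (1 - w) ^ 2 = (ψ w + c) ^ 2 / (2 * c) := by
      rw [h1]
      field_simp
    rw [h2, norm_div, norm_pow, norm_mul, Complex.norm_ofNat]
    have h3 : ‖ψ w + c‖ ≤ 2 * R := by
      have := norm_add_le (ψ w) c
      have := hw.2.2.2
      linarith
    calc (‖ψ w + c‖ ^ 2 / (2 * ‖c‖)) ^ 2 ≤ ((2 * R) ^ 2 / (2 * ‖c‖)) ^ 2 := by gcongr
      _ = 4 * R ^ 4 / ‖c‖ ^ 2 := by field_simp; ring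
  set f : ℂ → ℂ := fun w => D (ψ w) / (δ : ℂ) with hf
  have hnf : ∀ w, ‖f w‖ = ‖D (ψ w)‖ / δ := by
    intro w
    simp [hf, abs_of_pos hδ]
  have hfd : DifferentiableOn ℂ f (Metric.ball 0 1) := by
    refine DifferentiableOn.div_const ?_ _
    exact hD.comp (fun w hw => (hψd w hw).differentiableAt.differentiableWithinAt)
      (fun w hw => hψH w hw)
  rw [← himg, lintegral_image_eq_lintegral_abs_det_fderiv_mul volume hTo.measurableSet
    (f' := fun w => (ContinuousLinearMap.toSpanSingleton ℂ (2 * c / (1 - w) ^ 2)).restrictScalars ℝ)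
    (fun w hw => ((hψd w hw.1).hasFDerivAt.restrictScalars ℝ).hasFDerivWithinAt)
    (hψinj.mono Set.inter_subset_left)]
  have hstep : ∀ w ∈ T, ENNReal.ofReal
      |((ContinuousLinearMap.toSpanSingleton ℂ (2 * c / (1 - w) ^ 2)).restrictScalars ℝ).det| *
        ENNReal.ofReal (-Real.log (max ‖D (ψ w)‖ δ))
      ≤ ENNReal.ofReal (4 * R ^ 4 / ‖c‖ ^ 2) *
        ENNReal.ofReal (Real.log (1 / δ) - Real.posLog ‖f w‖) := by
    intro w hw
    rw [Complex.det_restrictScalars_toSpanSingleton, abs_of_nonneg (by positivity), hnf,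
      neg_log_max_eq (norm_nonneg _) hδ]
    gcongr
    exact hder w hw
  refine (setLIntegral_mono' hTo.measurableSet hstep).trans ?_
  rw [lintegral_const_mul' _ _ ENNReal.ofReal_ne_top]
  have hA := lintegral_annulus_log_sub_posLog_le (f := f) (K := 1 / δ) (a := 1 - 8 * ‖c‖ / R)
    (by rw [sub_nonneg, div_le_one hR0]; exact hR) (by rw [le_div_iff₀ hδ]; linarith) hfd
    (by
      intro w hw
      rw [hnf]
      gcongr
      exact hD1 _ (hψH w hw))
  refine (mul_le_mul_right ((lintegral_mono_set hTa).trans hA) _).trans ?_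
  rw [← ENNReal.ofReal_mul (by positivity), hnf, neg_log_max_eq (norm_nonneg _) hδ]
  have : ψ 0 = c := by simp [hψ]
  rw [this]
  refine ENNReal.ofReal_le_ofReal (le_of_eq ?_)
  field_simp
  ring

/-- The open half-plane on the side of `s * I`. -/
def sideHalf (s : ℝ) : Set ℂ := {z | 0 < s * z.im}

lemma isOpen_sideHalf (s : ℝ) : IsOpen (sideHalf s) :=
  isOpen_lt continuous_const (by fun_prop)

lemma ae_im_ne_zero : ∀ᵐ z : ℂ, z.im ≠ 0 := by
  have h := Measure.addHaar_submodule (volume : Measure ℂ) (LinearMap.ker Complex.imLm) (by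
    intro h
    have : Complex.I ∈ LinearMap.ker Complex.imLm := by rw [h]; trivial
    simp at this)
  rw [ae_iff]
  convert h using 2
  ext z
  simp

lemma posLog_le_of_mul_le {a d δ B : ℝ} (ha : 0 ≤ a) (hδ : 0 < δ) (hδ1 : δ ≤ 1)
    (hd1 : d ≤ 1) (hB : 1 ≤ B) (h1 : a * d ≤ B) (h2 : a * δ ≤ 1) :
    Real.posLog a ≤ Real.log B + -Real.log (max d δ) := by
  have hm : 0 < max d δ := lt_max_of_lt_right hδ
  rw [Real.posLog_eq_log_max_one ha, ← sub_eq_add_neg, ← Real.log_div (by linarith) hm.ne']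
  refine Real.log_le_log (by positivity) (max_le ?_ ?_)
  · rw [le_div_iff₀ hm, one_mul]
    exact max_le (hd1.trans hB) (hδ1.trans hB)
  · rw [le_div_iff₀ hm]
    rcases max_cases d δ with h | h
    · rw [h.1]; exact h1
    · rw [h.1]; exact h2.trans hB

lemma setLIntegral_side_neg_log_le {z₀ : ℂ} {r δ κ s : ℝ} (hs : |s| = 1) (hr : 0 < r)
    (hrz : 8 * r ≤ ‖z₀‖)
    (hδ : 0 < δ) (hδ1 : δ ≤ 1) (hκ : 0 < κ) {D : ℂ → ℂ}
    (hD : DifferentiableOn ℂ D (sideHalf s)) (hD1 : ∀ z ∈ sideHalf s, ‖D z‖ ≤ 1)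
    (hDκ : κ ≤ ‖D ((s * r : ℝ) * Complex.I)‖) :
    ∫⁻ z in sideHalf s ∩ Metric.ball z₀ (‖z₀‖ / 2), ENNReal.ofReal (-Real.log (max ‖D z‖ δ))
      ≤ ENNReal.ofReal (64 * Real.pi * ‖z₀‖ ^ 3 / r * Real.log (1 / κ)) := by
  set c : ℂ := (s * r : ℝ) * Complex.I with hcdef
  have hc : ‖c‖ = r := by simp [hcdef, hs, abs_of_pos hr]
  have hc0 : c ≠ 0 := by rw [← norm_pos_iff, hc]; exact hr
  have hset : ∀ z : ℂ, 0 < (z * (starRingEnd ℂ) c).re ↔ z ∈ sideHalf s := by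
    intro z
    have : (z * (starRingEnd ℂ) c).re = r * (s * z.im) := by
      simp [hcdef]; ring
    rw [this, sideHalf, Set.mem_ofPred_eq, mul_pos_iff_of_pos_left hr]
  have h := lintegral_halfPlane_neg_log_le hc0 (R := ‖z₀‖) (δ := δ) (D := D) (by rwa [hc]) hδ hδ1
    (hD.mono fun z hz => (hset z).1 hz) (fun z hz => hD1 z ((hset z).1 hz))
  rw [hc] at h
  refine (lintegral_mono_set ?_).trans (h.trans (ENNReal.ofReal_le_ofReal ?_))
  · rintro z ⟨h1, h2⟩
    rw [mem_ball_iff_norm] at h2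
    refine ⟨(hset z).2 h1, ?_, ?_⟩
    · have := norm_sub_norm_le z₀ z
      rw [norm_sub_rev] at this
      linarith
    · have := norm_sub_norm_le z z₀
      linarith
  · refine mul_le_mul_of_nonneg_left ?_ (by positivity)
    rw [one_div, Real.log_inv, neg_le_neg_iff]
    exact Real.log_le_log hκ (hDκ.trans (le_max_left _ _))

lemma posLog_norm_le_of_side_bounds {W : ℂ → ℂ} (hW : Differentiable ℂ W) {z₀ : ℂ} {r B κ : ℝ}
    (hr : 0 < r) (hrz : 8 * r ≤ ‖z₀‖) (hB : 1 ≤ B) (hκ : 0 < κ)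
    (hD : ∀ s : ℝ, |s| = 1 → ∃ D : ℂ → ℂ, DifferentiableOn ℂ D (sideHalf s) ∧
      (∀ z ∈ sideHalf s, ‖D z‖ ≤ 1) ∧
      (∀ z ∈ sideHalf s, z ∈ Metric.ball z₀ (‖z₀‖ / 2) → ‖W z * D z‖ ≤ B) ∧
      κ ≤ ‖D ((s * r : ℝ) * Complex.I)‖) :
    Real.posLog ‖W z₀‖ ≤ Real.log B + 512 * ‖z₀‖ / r * Real.log (1 / κ) := by
  have hz0 : 0 < ‖z₀‖ := by linarith
  obtain ⟨M, hM⟩ := (isCompact_closedBall z₀ (‖z₀‖ / 2)).exists_bound_of_continuousOn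
    hW.continuous.continuousOn
  set δ : ℝ := 1 / max M 1 with hδd
  have hδ : 0 < δ := by positivity
  have hδ1 : δ ≤ 1 := by
    rw [hδd, div_le_one (by positivity)]
    exact le_max_right _ _
  obtain ⟨D, hDd, hD1, hDB, hDκ⟩ := hD 1 (by simp)
  obtain ⟨E, hEd, hE1, hEB, hEκ⟩ := hD (-1) (by simp)
  have hκ1 : κ ≤ 1 := hDκ.trans (hD1 _ (by simpa [sideHalf] using hr))
  have hlog : 0 ≤ Real.log (1 / κ) := Real.log_nonneg (by rw [le_div_iff₀ hκ]; linarith)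
  have hlogB := Real.log_nonneg hB
  set b := Metric.ball z₀ (‖z₀‖ / 2) with hb
  set g : (ℂ → ℂ) → ℂ → ℝ≥0∞ := fun D z => ENNReal.ofReal (-Real.log (max ‖D z‖ δ)) with hg
  have hgm : Measurable ((sideHalf 1).indicator (g D)) := by
    refine ContinuousOn.measurable_indicator (isOpen_sideHalf 1).measurableSet ?_
    refine ENNReal.continuous_ofReal.comp_continuousOn (ContinuousOn.neg ?_)
    refine ContinuousOn.log ?_ ?_
    · exact hDd.continuousOn.norm.sup continuousOn_const
    · intro z _
      exact (lt_max_of_lt_right hδ).ne'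
  have hpt : ∀ᵐ z ∂(volume.restrict b), ENNReal.ofReal (Real.posLog ‖W z‖) ≤
      ENNReal.ofReal (Real.log B) +
        ((sideHalf 1).indicator (g D) z + (sideHalf (-1)).indicator (g E) z) := by
    filter_upwards [ae_restrict_of_ae ae_im_ne_zero, ae_restrict_mem measurableSet_ball] with z hz hzb
    have hWδ : ‖W z‖ * δ ≤ 1 := by
      rw [hδd, mul_one_div, div_le_one (by positivity)]
      exact (hM z (Metric.ball_subset_closedBall hzb)).trans (le_max_left _ _)
    rcases lt_or_gt_of_ne hz with h | h
    · have h1 : z ∉ sideHalf 1 := by simp [sideHalf, h.le]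
      have h2 : z ∈ sideHalf (-1) := by simpa [sideHalf] using h
      rw [Set.indicator_of_notMem h1, Set.indicator_of_mem h2, zero_add]
      refine le_trans (ENNReal.ofReal_le_ofReal ?_) ENNReal.ofReal_add_le
      exact posLog_le_of_mul_le (norm_nonneg _) hδ hδ1 (hE1 z h2) hB
        (by rw [← norm_mul]; exact hEB z h2 hzb) hWδ
    · have h1 : z ∉ sideHalf (-1) := by simp [sideHalf, h.le]
      have h2 : z ∈ sideHalf 1 := by simpa [sideHalf] using h
      rw [Set.indicator_of_notMem h1, Set.indicator_of_mem h2, add_zero]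
      refine le_trans (ENNReal.ofReal_le_ofReal ?_) ENNReal.ofReal_add_le
      exact posLog_le_of_mul_le (norm_nonneg _) hδ hδ1 (hD1 z h2) hB
        (by rw [← norm_mul]; exact hDB z h2 hzb) hWδ
  have h0 := posLog_norm_le_lintegral_ball (c := z₀) (half_pos hz0) (hW.differentiableOn)
  have h1 := h0.trans (lintegral_mono_ae hpt)
  rw [lintegral_add_left measurable_const, lintegral_add_left hgm,
    lintegral_indicator (isOpen_sideHalf _).measurableSet,
    lintegral_indicator (isOpen_sideHalf _).measurableSet,
    Measure.restrict_restrict (isOpen_sideHalf _).measurableSet,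
    Measure.restrict_restrict (isOpen_sideHalf _).measurableSet] at h1
  have h2 := h1.trans (add_le_add_right (add_le_add
    (setLIntegral_side_neg_log_le (by simp) hr hrz hδ hδ1 hκ hDd hD1 hDκ)
    (setLIntegral_side_neg_log_le (by simp) hr hrz hδ hδ1 hκ hEd hE1 hEκ)) _)
  have h3 : ∫⁻ _ in b, ENNReal.ofReal (Real.log B) =
      ENNReal.ofReal (Real.pi * (‖z₀‖ / 2) ^ 2 * Real.log B) := by
    rw [setLIntegral_const, hb, Complex.volume_ball, mul_comm,
      ENNReal.ofReal_mul (by positivity), mul_comm Real.pi, ENNReal.ofReal_mul (by positivity),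
      ENNReal.ofReal_pow (by positivity), ← NNReal.coe_real_pi, ENNReal.ofReal_coe_nnreal]
  have hpi := Real.pi_pos
  rw [h3, ← ENNReal.ofReal_add (by positivity) (by positivity),
    ← ENNReal.ofReal_add (by positivity) (by positivity),
    ENNReal.ofReal_le_ofReal_iff (by positivity)] at h2
  have hpos : 0 < Real.pi * (‖z₀‖ / 2) ^ 2 := by positivity
  refine le_of_mul_le_mul_left (h2.trans (le_of_eq ?_)) hpos
  field_simp
  ring

open Complex in
lemma norm_le_exp_of_upper {f : ℂ → ℂ} {B C σ : ℝ} (hσ : 0 ≤ σ)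
    (hf : DifferentiableOn ℂ f (sideHalf 1)) (hB : ∀ z ∈ sideHalf 1, ‖f z‖ ≤ B)
    (hC : ∀ y : ℝ, 0 < y → ‖f (y * I)‖ ≤ C * Real.exp (-(σ * y))) :
    ∀ z ∈ sideHalf 1, ‖f z‖ ≤ B * Real.exp (-(σ * z.im)) := by
  intro z hz
  have hz' : 0 < z.im := by simpa [sideHalf] using hz
  have hC0 : 0 ≤ C := by
    have := (norm_nonneg _).trans (hC 1 one_pos)
    exact nonneg_of_mul_nonneg_left this (Real.exp_pos _)
  have hB0 : 0 ≤ B := (norm_nonneg _).trans (hB z hz)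
  have main : ∀ δ : ℝ, 0 < δ → δ < z.im → ‖f z‖ ≤ B * Real.exp (-(σ * (z.im - δ))) := by
    intro δ hδ hδz
    set g : ℂ → ℂ := fun ζ => f (I * (ζ + δ)) * exp (σ * ζ) with hg
    have hmem : ∀ ζ : ℂ, 0 ≤ ζ.re → I * (ζ + δ) ∈ sideHalf 1 := by
      intro ζ h
      simp [sideHalf]
      linarith
    have hng : ∀ ζ : ℂ, ‖g ζ‖ = ‖f (I * (ζ + δ))‖ * Real.exp (σ * ζ.re) := by
      intro ζ
      rw [hg]
      simp [norm_exp]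
    have hgd : DifferentiableOn ℂ g {ζ | -δ < ζ.re} := by
      refine DifferentiableOn.mul ?_ (by fun_prop)
      refine hf.comp (by fun_prop) ?_
      intro ζ h
      have h' : -δ < ζ.re := h
      simp [sideHalf]
      linarith
    have hgc : DiffContOnCl ℂ g {ζ | 0 < ζ.re} := by
      refine (hgd.mono ?_).diffContOnCl
      intro ζ h
      rw [closure_setOfPred_lt_re] at h
      have h' : 0 ≤ ζ.re := h
      show -δ < ζ.re
      linarith
    have key := PhragmenLindelof.right_half_plane_of_bounded_on_real (C := B)
      (z := -(I * z) - δ) hgc ⟨1, by norm_num, σ, ?_⟩ ?_ ?_ ?_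
    · rw [hng] at key
      have e1 : I * (-(I * z) - δ + δ) = z := by
        ring_nf
        simp
      have e2 : (-(I * z) - (δ : ℂ)).re = z.im - δ := by simp
      rw [e1, e2] at key
      rw [Real.exp_neg, ← div_eq_mul_inv, le_div_iff₀ (Real.exp_pos _)]
      exact key
    · refine Asymptotics.IsBigO.of_bound B ?_
      refine eventually_inf_principal.2 (Eventually.of_forall fun ζ hζ => ?_)
      have hζ' : 0 < ζ.re := hζ
      rw [hng, Real.rpow_one, Real.norm_of_nonneg (Real.exp_pos _).le]
      refine mul_le_mul (hB _ (hmem ζ hζ'.le)) ?_ (Real.exp_pos _).le hB0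
      exact Real.exp_le_exp.2 (mul_le_mul_of_nonneg_left (re_le_norm ζ) hσ)
    · refine ⟨C, eventually_map.2 ?_⟩
      filter_upwards [eventually_gt_atTop 0] with x hx
      rw [hng]
      have e1 : I * ((x : ℂ) + δ) = ((x + δ : ℝ) : ℂ) * I := by push_cast; ring
      rw [e1]
      calc _ ≤ C * Real.exp (-(σ * (x + δ))) * Real.exp (σ * x) :=
            mul_le_mul_of_nonneg_right (hC _ (by linarith)) (Real.exp_pos _).le
        _ = C * Real.exp (-(σ * δ)) := by
          rw [mul_assoc, ← Real.exp_add]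
          congr 2
          ring
        _ ≤ C := mul_le_of_le_one_right hC0 (Real.exp_le_one_iff.2 (by nlinarith))
    · intro x
      rw [hng]
      simpa using hB _ (hmem (x * I) (by simp))
    · simp
      linarith
  have hlim : Tendsto (fun δ : ℝ => B * Real.exp (-(σ * (z.im - δ)))) (nhdsWithin 0 (Set.Ioi 0))
      (nhds (B * Real.exp (-(σ * (z.im - 0))))) := by
    refine Tendsto.mono_left ?_ nhdsWithin_le_nhds
    exact Continuous.tendsto (by fun_prop) 0
  rw [sub_zero] at hlim
  refine ge_of_tendsto hlim ?_
  filter_upwards [Ioo_mem_nhdsGT hz'] with δ hδ using main δ hδ.1 hδ.2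

open Complex in
lemma exists_posLog_norm_le_of_upper {W E : ℂ → ℂ} {B C ε : ℝ} (hε : 0 < ε)
    (hW : Differentiable ℂ W) (hWs : ∀ z, ‖W ((starRingEnd ℂ) z)‖ = ‖W z‖)
    (hE : DifferentiableOn ℂ E (sideHalf 1)) (hE1 : ∀ z ∈ sideHalf 1, ‖E z‖ ≤ 1)
    (hE0 : ∃ z ∈ sideHalf 1, E z ≠ 0) (hWE : ∀ z ∈ sideHalf 1, ‖W z * E z‖ ≤ B)
    (hWC : ∀ y : ℝ, ‖W (y * I)‖ ≤ C) :
    ∃ r K : ℝ, ∀ z, r ≤ ‖z‖ → Real.posLog ‖W z‖ ≤ K + 512 * ε * ‖z‖ := by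
  set P : ℕ → Prop := fun n => ∀ z ∈ sideHalf 1, ‖E z‖ ≤ Real.exp (-(n * ε * z.im)) with hP
  have hP0 : P 0 := by
    intro z hz
    simpa using hE1 z hz
  obtain ⟨n, hn, hn1⟩ : ∃ n, P n ∧ ¬ P (n + 1) := by
    by_contra! h
    have hall : ∀ n, P n := fun n => Nat.rec hP0 (fun n hn => h n hn) n
    obtain ⟨z, hz, hEz⟩ := hE0
    have hz' : 0 < z.im := by simpa [sideHalf] using hz
    have ht : Tendsto (fun n : ℕ => Real.exp (-(n * ε * z.im))) atTop (nhds 0) := by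
      refine Real.tendsto_exp_neg_atTop_nhds_zero.comp ?_
      exact (tendsto_natCast_atTop_atTop.atTop_mul_const hε).atTop_mul_const hz'
    have := ge_of_tendsto ht (Eventually.of_forall fun n => hall n z hz)
    exact hEz (norm_le_zero_iff.1 this)
  set E₁ : ℂ → ℂ := fun z => exp (-(n * ε * I * z)) * E z with hE₁
  have hnE : ∀ z, ‖E₁ z‖ = Real.exp (n * ε * z.im) * ‖E z‖ := by
    intro z
    rw [hE₁, norm_mul, norm_exp]
    congr 2
    have : -(n * ε * I * z : ℂ) = ((n * ε : ℝ) : ℂ) * (-(I * z)) := by push_cast; ring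
    rw [this, re_ofReal_mul]
    simp
  have hE₁1 : ∀ z ∈ sideHalf 1, ‖E₁ z‖ ≤ 1 := by
    intro z hz
    rw [hnE]
    have := hn z hz
    calc _ ≤ Real.exp (n * ε * z.im) * Real.exp (-(n * ε * z.im)) := by gcongr
      _ = 1 := by rw [← Real.exp_add]; simp
  have hWE₁ : ∀ z ∈ sideHalf 1, ‖W z * E₁ z‖ ≤ B := by
    intro z hz
    have h := norm_le_exp_of_upper (f := fun z => W z * E z) (σ := n * ε) (C := C) (by positivity)
      (hW.differentiableOn.mul hE) hWE (by
        intro y hy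
        have hy' : (y : ℂ) * I ∈ sideHalf 1 := by simpa [sideHalf] using hy
        have := hn _ hy'
        rw [norm_mul]
        refine mul_le_mul (hWC y) ?_ (norm_nonneg _) ((norm_nonneg _).trans (hWC y))
        simpa using this) z hz
    rw [norm_mul, hnE]
    rw [norm_mul] at h
    calc _ = (‖W z‖ * ‖E z‖) * Real.exp (n * ε * z.im) := by ring
      _ ≤ B * Real.exp (-(n * ε * z.im)) * Real.exp (n * ε * z.im) := by gcongr
      _ = B := by rw [mul_assoc, ← Real.exp_add]; simp
  obtain ⟨r, hr, hrE⟩ : ∃ r : ℝ, 0 < r ∧ Real.exp (-(ε * r)) ≤ ‖E₁ (r * I)‖ := by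
    by_contra! h
    apply hn1
    have := norm_le_exp_of_upper (f := E) (σ := (n + 1 : ℕ) * ε) (C := 1) (by positivity)
      hE hE1 (by
        intro y hy
        have h1 := h y hy
        rw [hnE] at h1
        have h2 : ((y : ℂ) * I).im = y := by simp
        rw [h2] at h1
        have h3 : Real.exp (-(((n + 1 : ℕ) : ℝ) * ε * y)) =
            Real.exp (-(n * ε * y)) * Real.exp (-(ε * y)) := by
          rw [← Real.exp_add]
          push_cast
          congr 1
          ring
        rw [h3, one_mul]
        calc ‖E (y * I)‖ = Real.exp (-(n * ε * y)) * (Real.exp (n * ε * y) * ‖E (y * I)‖) := by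
              rw [← mul_assoc, ← Real.exp_add]; simp
          _ ≤ _ := by gcongr)
    intro z hz
    simpa using this z hz
  refine ⟨8 * r, Real.log (max B 1), fun z hz => ?_⟩
  have hcore := posLog_norm_le_of_side_bounds hW hr hz (le_max_right B 1)
    (Real.exp_pos (-(ε * r))) (by
      intro s hs
      have hE₁d : DifferentiableOn ℂ E₁ (sideHalf 1) :=
        DifferentiableOn.mul (by fun_prop) hE
      rcases (abs_eq zero_le_one).1 hs with rfl | rfl
      · exact ⟨E₁, hE₁d, hE₁1, fun z hz _ => (hWE₁ z hz).trans (le_max_left _ _), by simpa using hrE⟩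
      · have hcj : ∀ z ∈ sideHalf (-1), (starRingEnd ℂ) z ∈ sideHalf 1 := by
          intro z hz
          simpa [sideHalf] using hz
        refine ⟨fun z => (starRingEnd ℂ) (E₁ ((starRingEnd ℂ) z)), ?_, ?_, ?_, ?_⟩
        · intro z hz
          have h1 := (hE₁d _ (hcj z hz)).differentiableAt ((isOpen_sideHalf 1).mem_nhds (hcj z hz))
          have := h1.conj_conj
          rw [starRingEnd_self_apply] at this
          exact this.differentiableWithinAt
        · intro z hz
          rw [norm_conj]
          exact hE₁1 _ (hcj z hz)
        · intro z hz _
          rw [norm_mul, norm_conj, ← hWs, ← norm_mul]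
          exact (hWE₁ _ (hcj z hz)).trans (le_max_left _ _)
        · rw [norm_conj]
          simpa using hrE)
  refine hcore.trans (le_of_eq ?_)
  rw [one_div, ← Real.exp_neg, neg_neg, Real.log_exp]
  field_simp

open Complex in
lemma norm_le_of_subexponential {W : ℂ → ℂ} {C : ℝ} (hW : Differentiable ℂ W)
    (hexp : ∀ ε : ℝ, 0 < ε → ∃ K, ∀ z, ‖W z‖ ≤ K * Real.exp (ε * ‖z‖))
    (hWC : ∀ y : ℝ, ‖W (y * I)‖ ≤ C) {z : ℂ} (hz : 0 ≤ z.re) : ‖W z‖ ≤ C := by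
  have main : ∀ ε : ℝ, 0 < ε → ‖W z‖ ≤ C * Real.exp (ε * z.re) := by
    intro ε hε
    obtain ⟨K, hK⟩ := hexp ε hε
    have hK0 : 0 ≤ K := nonneg_of_mul_nonneg_left ((norm_nonneg _).trans (hK 0)) (Real.exp_pos _)
    have hng : ∀ ζ : ℂ, ‖W ζ * exp (-(ε * ζ))‖ = ‖W ζ‖ * Real.exp (-(ε * ζ.re)) := by
      intro ζ
      simp [norm_exp]
    have key := PhragmenLindelof.right_half_plane_of_bounded_on_real (C := C) (z := z)
      (f := fun ζ => W ζ * exp (-(ε * ζ))) ?_ ⟨1, by norm_num, ε, ?_⟩ ?_ ?_ hz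
    · rw [hng, Real.exp_neg, ← div_eq_mul_inv, div_le_iff₀ (Real.exp_pos _)] at key
      exact key
    · exact Differentiable.diffContOnCl (by fun_prop)
    · refine Asymptotics.IsBigO.of_bound K ?_
      refine eventually_inf_principal.2 (Eventually.of_forall fun ζ hζ => ?_)
      have hζ' : 0 < ζ.re := hζ
      rw [hng, Real.rpow_one, Real.norm_of_nonneg (Real.exp_pos _).le]
      calc _ ≤ ‖W ζ‖ * 1 := by
            gcongr
            exact Real.exp_le_one_iff.2 (by nlinarith)
        _ ≤ _ := by rw [mul_one]; exact hK ζ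
    · refine ⟨K, eventually_map.2 ?_⟩
      filter_upwards [eventually_gt_atTop 0] with x hx
      rw [hng, ofReal_re]
      have := hK x
      rw [norm_real, Real.norm_of_nonneg hx.le] at this
      rw [Real.exp_neg, ← div_eq_mul_inv, div_le_iff₀ (Real.exp_pos _)]
      exact this
    · intro x
      rw [hng]
      simpa using hWC x
  have hlim : Tendsto (fun ε : ℝ => C * Real.exp (ε * z.re)) (nhdsWithin 0 (Set.Ioi 0))
      (nhds (C * Real.exp (0 * z.re))) := by
    refine Tendsto.mono_left ?_ nhdsWithin_le_nhds
    exact Continuous.tendsto (by fun_prop) 0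
  rw [zero_mul, Real.exp_zero, mul_one] at hlim
  refine ge_of_tendsto hlim ?_
  filter_upwards [self_mem_nhdsWithin] with δ hδ using main δ hδ

open Complex in
/-- A symmetric entire function of bounded type in the upper half-plane which decays along the
imaginary axis vanishes. -/
lemma eq_zero_of_upper_bounded_type {W E : ℂ → ℂ} {B C : ℝ}
    (hW : Differentiable ℂ W) (hWs : ∀ z, ‖W ((starRingEnd ℂ) z)‖ = ‖W z‖)
    (hE : DifferentiableOn ℂ E (sideHalf 1)) (hE1 : ∀ z ∈ sideHalf 1, ‖E z‖ ≤ 1)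
    (hE0 : ∃ z ∈ sideHalf 1, E z ≠ 0) (hWE : ∀ z ∈ sideHalf 1, ‖W z * E z‖ ≤ B)
    (hWC : ∀ y : ℝ, ‖W (y * I)‖ ≤ C)
    (hW0 : Tendsto (fun y : ℝ => W (y * I)) atTop (nhds 0)) : ∀ z, W z = 0 := by
  have hexp : ∀ ε : ℝ, 0 < ε → ∃ K, ∀ z, ‖W z‖ ≤ K * Real.exp (ε * ‖z‖) := by
    intro ε hε
    obtain ⟨r, K, hK⟩ := exists_posLog_norm_le_of_upper (ε := ε / 512) (by positivity)
      hW hWs hE hE1 hE0 hWE hWC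
    obtain ⟨M, hM⟩ := (isCompact_closedBall (0 : ℂ) r).exists_bound_of_continuousOn
      hW.continuous.continuousOn
    refine ⟨max M (Real.exp K), fun z => ?_⟩
    rcases le_total r ‖z‖ with h | h
    · have h1 := hK z h
      have h2 : ‖W z‖ ≤ Real.exp (Real.posLog ‖W z‖) := by
        rcases (norm_nonneg (W z)).eq_or_lt with h0 | h0
        · rw [← h0]; positivity
        · calc ‖W z‖ = Real.exp (Real.log ‖W z‖) := (Real.exp_log h0).symm
            _ ≤ _ := Real.exp_le_exp.2 (le_max_right _ _)
      calc ‖W z‖ ≤ Real.exp (Real.posLog ‖W z‖) := h2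
        _ ≤ Real.exp (K + ε * ‖z‖) := Real.exp_le_exp.2 (by linarith)
        _ = Real.exp K * Real.exp (ε * ‖z‖) := Real.exp_add _ _
        _ ≤ _ := by gcongr; exact le_max_right _ _
    · have h1 := hM z (by simpa using h)
      have h3 : 0 ≤ M := (norm_nonneg _).trans h1
      calc ‖W z‖ ≤ M * 1 := by rwa [mul_one]
        _ ≤ _ := by
          gcongr
          · exact le_max_left _ _
          · exact Real.one_le_exp (by positivity)
  have hb : ∀ z, ‖W z‖ ≤ C := by
    intro z
    rcases le_total 0 z.re with h | h
    · exact norm_le_of_subexponential hW hexp hWC h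
    · have := norm_le_of_subexponential (W := fun z => W (-z)) (C := C) (z := -z)
        (hW.comp differentiable_neg) (fun ε hε => by
          obtain ⟨K, hK⟩ := hexp ε hε
          exact ⟨K, fun z => by simpa using hK (-z)⟩)
        (fun y => by simpa using hWC (-y)) (by simpa using h)
      simpa using this
  have hbd : Bornology.IsBounded (Set.range W) := by
    rw [isBounded_iff_forall_norm_le]
    exact ⟨C, by rintro _ ⟨z, rfl⟩; exact hb z⟩
  intro z
  have hc : ∀ y : ℝ, W (y * I) = W z := fun y => hW.apply_eq_apply_of_bounded hbd _ _
  simp_rw [hc] at hW0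
  exact tendsto_nhds_unique tendsto_const_nhds hW0

/-- The Cauchy transform of the complex measure `h dμ`. -/
noncomputable def cauchyTransform (μ : Measure ℝ) (h : ℝ → ℂ) (w : ℂ) : ℂ :=
  ∫ x, h x / ((x : ℂ) - w) ∂μ

section cauchyTransform

variable {μ : Measure ℝ} {h : ℝ → ℂ} {w : ℂ}

lemma im_le_norm_ofReal_sub (x : ℝ) (w : ℂ) : |w.im| ≤ ‖(x : ℂ) - w‖ := by
  simpa using Complex.abs_im_le_norm ((x : ℂ) - w)

lemma ofReal_sub_ne_zero (hw : w.im ≠ 0) (x : ℝ) : (x : ℂ) - w ≠ 0 := by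
  rw [← norm_pos_iff]
  exact (abs_pos.2 hw).trans_le (im_le_norm_ofReal_sub x w)

lemma norm_div_ofReal_sub_le (hw : w.im ≠ 0) (a : ℂ) (x : ℝ) :
    ‖a / ((x : ℂ) - w)‖ ≤ ‖a‖ / |w.im| := by
  rw [norm_div]
  exact div_le_div_of_nonneg_left (norm_nonneg _) (abs_pos.2 hw) (im_le_norm_ofReal_sub x w)

lemma integrable_div_ofReal_sub (hh : Integrable h μ) (hw : w.im ≠ 0) :
    Integrable (fun x : ℝ => h x / ((x : ℂ) - w)) μ := by
  refine (hh.norm.div_const |w.im|).mono' ?_ ?_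
  · exact hh.aestronglyMeasurable.div₀
      (by fun_prop : Continuous fun x : ℝ => (x : ℂ) - w).aestronglyMeasurable
  · exact Eventually.of_forall fun x => norm_div_ofReal_sub_le hw _ x

lemma norm_cauchyTransform_le (hh : Integrable h μ) (hw : w.im ≠ 0) :
    ‖cauchyTransform μ h w‖ ≤ (∫ x, ‖h x‖ ∂μ) / |w.im| := by
  rw [cauchyTransform, ← integral_div]
  exact norm_integral_le_of_norm_le (hh.norm.div_const _)
    (Eventually.of_forall fun x => norm_div_ofReal_sub_le hw _ x)

lemma differentiableAt_cauchyTransform (hh : Integrable h μ) (hw : w.im ≠ 0) :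
    DifferentiableAt ℂ (cauchyTransform μ h) w := by
  have hp : 0 < |w.im| / 2 := half_pos (abs_pos.2 hw)
  have him : ∀ v ∈ Metric.ball w (|w.im| / 2), |w.im| / 2 ≤ |v.im| := by
    intro v hv
    rw [mem_ball_iff_norm] at hv
    have h1 := Complex.abs_im_le_norm (v - w)
    have h2 := abs_sub_abs_le_abs_sub w.im v.im
    rw [Complex.sub_im, abs_sub_comm] at h1
    linarith
  have him0 : ∀ v ∈ Metric.ball w (|w.im| / 2), v.im ≠ 0 :=
    fun v hv => abs_pos.1 (hp.trans_le (him v hv))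
  have key := hasDerivAt_integral_of_dominated_loc_of_deriv_le (μ := μ) (𝕜 := ℂ)
    (F := fun (v : ℂ) (x : ℝ) => h x / ((x : ℂ) - v))
    (F' := fun (v : ℂ) (x : ℝ) => h x / ((x : ℂ) - v) / ((x : ℂ) - v)) (x₀ := w)
    (bound := fun x => ‖h x‖ / (|w.im| / 2) / (|w.im| / 2))
    (Metric.ball_mem_nhds w hp) ?_ ?_ ?_ ?_ ?_ ?_
  · exact key.2.differentiableAt
  · filter_upwards [Metric.ball_mem_nhds w hp] with v hv
    exact (integrable_div_ofReal_sub hh (him0 v hv)).aestronglyMeasurable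
  · exact integrable_div_ofReal_sub hh hw
  · exact (integrable_div_ofReal_sub (integrable_div_ofReal_sub hh hw) hw).aestronglyMeasurable
  · refine Eventually.of_forall fun x v hv => ?_
    refine (norm_div_ofReal_sub_le (him0 v hv) _ x).trans ?_
    gcongr
    · refine (norm_div_ofReal_sub_le (him0 v hv) _ x).trans ?_
      gcongr
      exact him v hv
    · exact him v hv
  · exact (hh.norm.div_const _).div_const _
  · refine Eventually.of_forall fun x v hv => ?_
    have h1 : HasDerivAt (fun v : ℂ => (x : ℂ) - v) (-1) v := by
      simpa using (hasDerivAt_id v).const_sub (x : ℂ)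
    have h2 := (hasDerivAt_const v (h x)).div h1 (ofReal_sub_ne_zero (him0 v hv) x)
    have h3 : (0 * ((x : ℂ) - v) - h x * -1) / ((x : ℂ) - v) ^ 2
        = h x / ((x : ℂ) - v) / ((x : ℂ) - v) := by
      rw [div_div, sq]
      congr 1
      ring
    rwa [h3] at h2

lemma cauchyTransform_sub {h' : ℝ → ℂ} (hh : Integrable h μ) (hh' : Integrable h' μ)
    (hw : w.im ≠ 0) : cauchyTransform μ (fun x => h x - h' x) w
      = cauchyTransform μ h w - cauchyTransform μ h' w := by
  simp only [cauchyTransform, sub_div]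
  exact integral_sub (integrable_div_ofReal_sub hh hw) (integrable_div_ofReal_sub hh' hw)

lemma cauchyTransform_add {h' : ℝ → ℂ} (hh : Integrable h μ) (hh' : Integrable h' μ)
    (hw : w.im ≠ 0) : cauchyTransform μ (fun x => h x + h' x) w
      = cauchyTransform μ h w + cauchyTransform μ h' w := by
  simp only [cauchyTransform, add_div]
  exact integral_add (integrable_div_ofReal_sub hh hw) (integrable_div_ofReal_sub hh' hw)

lemma cauchyTransform_const_mul (c : ℂ) :
    cauchyTransform μ (fun x => c * h x) w = c * cauchyTransform μ h w := by
  simp only [cauchyTransform, mul_div_assoc]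
  exact integral_const_mul _ _

lemma sideHalf_im_ne_zero {s : ℝ} (hw : w ∈ sideHalf s) : w.im ≠ 0 := by
  rintro h
  simp [sideHalf, h] at hw

lemma im_cauchyTransform_nonneg {p : ℝ → ℝ} (hp : Integrable p μ) (hp0 : ∀ x, 0 ≤ p x) {s : ℝ}
    (hw : w ∈ sideHalf s) : 0 ≤ s * (cauchyTransform μ (fun x => (p x : ℂ)) w).im := by
  have hi := integrable_div_ofReal_sub (hp.ofReal (𝕜 := ℂ)) (sideHalf_im_ne_zero hw)
  have h1 : (cauchyTransform μ (fun x => (p x : ℂ)) w).im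
      = ∫ x, ((p x : ℂ) / ((x : ℂ) - w)).im ∂μ :=
    (Complex.imCLM.integral_comp_comm hi).symm
  rw [h1, ← integral_const_mul]
  refine integral_nonneg fun x => ?_
  have : ((p x : ℂ) / ((x : ℂ) - w)).im = p x * w.im / Complex.normSq ((x : ℂ) - w) := by
    rw [Complex.div_im]
    simp
    ring
  show 0 ≤ s * ((p x : ℂ) / ((x : ℂ) - w)).im
  rw [this]
  have hw' : 0 < s * w.im := hw
  have h2 : s * (p x * w.im / Complex.normSq ((x : ℂ) - w))
      = p x * (s * w.im) / Complex.normSq ((x : ℂ) - w) := by ring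
  rw [h2]
  have := Complex.normSq_nonneg ((x : ℂ) - w)
  have := hp0 x
  positivity

lemma exists_bounded_quotient_of_nonneg {p : ℝ → ℝ} (hp : Integrable p μ) (hp0 : ∀ x, 0 ≤ p x)
    {s : ℝ} (hs : |s| = 1) {M : ℝ} (hM : ∫ x, p x ∂μ ≤ M) :
    ∃ D : ℂ → ℂ, DifferentiableOn ℂ D (sideHalf s) ∧ ∀ w ∈ sideHalf s, ‖D w‖ ≤ 1 ∧
      ‖D w * cauchyTransform μ (fun x => (p x : ℂ)) w‖ ≤ 2 ∧ (1 + M / |w.im|)⁻¹ ≤ ‖D w‖ := by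
  set f := cauchyTransform μ (fun x => (p x : ℂ)) with hf
  have hge : ∀ w ∈ sideHalf s, 1 ≤ ‖f w + s * Complex.I‖ := by
    intro w hw
    have h1 := im_cauchyTransform_nonneg hp hp0 hw
    have h2 := Complex.abs_im_le_norm (f w + s * Complex.I)
    have h3 : |s * (f w + s * Complex.I).im| = |(f w + s * Complex.I).im| := by
      rw [abs_mul, hs, one_mul]
    have h4 : s * (f w + s * Complex.I).im = s * (f w).im + |s| ^ 2 := by
      simp; ring
    rw [hs] at h4
    have h5 := le_abs_self (s * (f w + s * Complex.I).im)
    rw [← hf] at h1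
    linarith
  have hne : ∀ w ∈ sideHalf s, f w + s * Complex.I ≠ 0 := fun w hw =>
    norm_pos_iff.1 (one_pos.trans_le (hge w hw))
  have hD1 : ∀ w ∈ sideHalf s, ‖(f w + s * Complex.I)⁻¹‖ ≤ 1 := fun w hw => by
    rw [norm_inv]
    exact inv_le_one_of_one_le₀ (hge w hw)
  have hsI : ‖(s * Complex.I : ℂ)‖ = 1 := by simpa using hs
  refine ⟨fun w => (f w + s * Complex.I)⁻¹, ?_, fun w hw => ⟨hD1 w hw, ?_, ?_⟩⟩
  · intro w hw
    have := differentiableAt_cauchyTransform (hp.ofReal (𝕜 := ℂ)) (sideHalf_im_ne_zero hw)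
    exact ((this.add_const _).inv (hne w hw)).differentiableWithinAt
  · have h1 : (f w + s * Complex.I)⁻¹ * f w = 1 - (s * Complex.I) * (f w + s * Complex.I)⁻¹ := by
      have := hne w hw
      field_simp
      ring
    rw [h1]
    refine (norm_sub_le _ _).trans ?_
    rw [norm_mul, hsI, norm_one, one_mul]
    have := hD1 w hw
    linarith
  · rw [norm_inv]
    refine inv_anti₀ (one_pos.trans_le (hge w hw)) ?_
    refine (norm_add_le _ _).trans ?_
    rw [hsI, add_comm]
    gcongr
    refine (norm_cauchyTransform_le (hp.ofReal (𝕜 := ℂ)) (sideHalf_im_ne_zero hw)).trans ?_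
    gcongr
    refine le_trans (le_of_eq (integral_congr_ae (Eventually.of_forall fun x => ?_))) hM
    simpa using hp0 x

/-- The Cauchy transform of an integrable function is of bounded type in each half-plane, with a
denominator which is controlled from below. -/
lemma exists_bounded_quotient_cauchyTransform (hh : Integrable h μ) {s : ℝ} (hs : |s| = 1) :
    ∃ D : ℂ → ℂ, DifferentiableOn ℂ D (sideHalf s) ∧ ∀ w ∈ sideHalf s, ‖D w‖ ≤ 1 ∧
      ‖D w * cauchyTransform μ h w‖ ≤ 8 ∧
      ((1 + (∫ x, ‖h x‖ ∂μ) / |w.im|) ^ 4)⁻¹ ≤ ‖D w‖ := by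
  have hre : Integrable (fun x => (h x).re) μ := hh.re
  have him : Integrable (fun x => (h x).im) μ := hh.im
  have hb : ∀ p : ℝ → ℝ, Integrable p μ → (∀ x, p x ≤ ‖h x‖) → ∫ x, p x ∂μ ≤ ∫ x, ‖h x‖ ∂μ :=
    fun p hp hle => integral_mono hp hh.norm hle
  have hreb : ∀ x, |(h x).re| ≤ ‖h x‖ := fun x => Complex.abs_re_le_norm _
  have himb : ∀ x, |(h x).im| ≤ ‖h x‖ := fun x => Complex.abs_im_le_norm _
  have hi1 := hre.pos_part
  have hi2 := hre.neg_part
  have hi3 := him.pos_part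
  have hi4 := him.neg_part
  obtain ⟨D1, hd1, h1⟩ := exists_bounded_quotient_of_nonneg hi1 (fun x => le_max_right _ _) hs
    (hb _ hi1 fun x => max_le ((le_abs_self _).trans (hreb x)) (norm_nonneg _))
  obtain ⟨D2, hd2, h2⟩ := exists_bounded_quotient_of_nonneg hi2 (fun x => le_max_right _ _) hs
    (hb _ hi2 fun x => max_le ((neg_le_abs _).trans (hreb x)) (norm_nonneg _))
  obtain ⟨D3, hd3, h3⟩ := exists_bounded_quotient_of_nonneg hi3 (fun x => le_max_right _ _) hs
    (hb _ hi3 fun x => max_le ((le_abs_self _).trans (himb x)) (norm_nonneg _))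
  obtain ⟨D4, hd4, h4⟩ := exists_bounded_quotient_of_nonneg hi4 (fun x => le_max_right _ _) hs
    (hb _ hi4 fun x => max_le ((neg_le_abs _).trans (himb x)) (norm_nonneg _))
  refine ⟨fun w => D1 w * D2 w * D3 w * D4 w, ((hd1.mul hd2).mul hd3).mul hd4, fun w hw => ?_⟩
  obtain ⟨a1, b1, c1⟩ := h1 w hw
  obtain ⟨a2, b2, c2⟩ := h2 w hw
  obtain ⟨a3, b3, c3⟩ := h3 w hw
  obtain ⟨a4, b4, c4⟩ := h4 w hw
  have hw0 := sideHalf_im_ne_zero hw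
  have hdec : cauchyTransform μ h w =
      (cauchyTransform μ (fun x => ((max (h x).re 0 : ℝ) : ℂ)) w -
        cauchyTransform μ (fun x => ((max (-(h x).re) 0 : ℝ) : ℂ)) w) +
      Complex.I * (cauchyTransform μ (fun x => ((max (h x).im 0 : ℝ) : ℂ)) w -
        cauchyTransform μ (fun x => ((max (-(h x).im) 0 : ℝ) : ℂ)) w) := by
    have i1 : Integrable (fun x => ((max (h x).re 0 : ℝ) : ℂ)) μ := hi1.ofReal
    have i2 : Integrable (fun x => ((max (-(h x).re) 0 : ℝ) : ℂ)) μ := hi2.ofReal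
    have i3 : Integrable (fun x => ((max (h x).im 0 : ℝ) : ℂ)) μ := hi3.ofReal
    have i4 : Integrable (fun x => ((max (-(h x).im) 0 : ℝ) : ℂ)) μ := hi4.ofReal
    rw [← cauchyTransform_sub i1 i2 hw0, ← cauchyTransform_sub i3 i4 hw0,
      ← cauchyTransform_const_mul, ← cauchyTransform_add
      (h := fun x => ((max (h x).re 0 : ℝ) : ℂ) - ((max (-(h x).re) 0 : ℝ) : ℂ))
      (h' := fun x => Complex.I * (((max (h x).im 0 : ℝ) : ℂ) - ((max (-(h x).im) 0 : ℝ) : ℂ)))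
      (i1.sub i2) ((i3.sub i4).const_mul _) hw0]
    congr 1
    ext x
    have e : ∀ t : ℝ, ((max t 0 : ℝ) : ℂ) - ((max (-t) 0 : ℝ) : ℂ) = t := by
      intro t
      rw [← Complex.ofReal_sub, max_zero_sub_max_neg_zero_eq_self]
    show h x = (((max (h x).re 0 : ℝ) : ℂ) - ((max (-(h x).re) 0 : ℝ) : ℂ)) +
      Complex.I * (((max (h x).im 0 : ℝ) : ℂ) - ((max (-(h x).im) 0 : ℝ) : ℂ))
    rw [e, e, mul_comm, Complex.re_add_im]
  set f1 := cauchyTransform μ (fun x => ((max (h x).re 0 : ℝ) : ℂ)) w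
  set f2 := cauchyTransform μ (fun x => ((max (-(h x).re) 0 : ℝ) : ℂ)) w
  set f3 := cauchyTransform μ (fun x => ((max (h x).im 0 : ℝ) : ℂ)) w
  set f4 := cauchyTransform μ (fun x => ((max (-(h x).im) 0 : ℝ) : ℂ)) w
  refine ⟨?_, ?_, ?_⟩
  · simp only [norm_mul]
    calc _ ≤ (1 : ℝ) * 1 * 1 * 1 := by gcongr
      _ = 1 := by norm_num
  · have e : D1 w * D2 w * D3 w * D4 w * cauchyTransform μ h w =
        (D1 w * f1) * (D2 w * (D3 w * D4 w)) - (D2 w * f2) * (D1 w * (D3 w * D4 w)) +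
        (Complex.I * (D3 w * f3) * (D1 w * (D2 w * D4 w)) -
          Complex.I * (D4 w * f4) * (D1 w * (D2 w * D3 w))) := by
      rw [hdec]; ring
    have b : ∀ x y z t : ℂ, ‖x‖ ≤ 2 → ‖y‖ ≤ 1 → ‖z‖ ≤ 1 → ‖t‖ ≤ 1 → ‖x * (y * (z * t))‖ ≤ 2 := by
      intro x y z t hx hy hz ht
      simp only [norm_mul]
      calc _ ≤ (2 : ℝ) * (1 * (1 * 1)) := by gcongr
        _ = 2 := by norm_num
    have hI : ∀ x : ℂ, ‖x‖ ≤ 2 → ‖Complex.I * x‖ ≤ 2 := fun x hx => by simpa using hx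
    rw [e]
    refine (norm_add_le _ _).trans ?_
    have t1 := norm_sub_le ((D1 w * f1) * (D2 w * (D3 w * D4 w)))
      ((D2 w * f2) * (D1 w * (D3 w * D4 w)))
    have t2 := norm_sub_le (Complex.I * (D3 w * f3) * (D1 w * (D2 w * D4 w)))
      (Complex.I * (D4 w * f4) * (D1 w * (D2 w * D3 w)))
    have u1 := b _ _ _ _ b1 a2 a3 a4
    have u2 := b _ _ _ _ b2 a1 a3 a4
    have u3 := b _ _ _ _ (hI _ b3) a1 a2 a4
    have u4 := b _ _ _ _ (hI _ b4) a1 a2 a3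
    linarith
  · simp only [norm_mul]
    have hM : 0 ≤ (∫ x, ‖h x‖ ∂μ) / |w.im| := by positivity
    have : ((1 + (∫ x, ‖h x‖ ∂μ) / |w.im|) ^ 4)⁻¹ = (1 + (∫ x, ‖h x‖ ∂μ) / |w.im|)⁻¹ *
        (1 + (∫ x, ‖h x‖ ∂μ) / |w.im|)⁻¹ * (1 + (∫ x, ‖h x‖ ∂μ) / |w.im|)⁻¹ *
        (1 + (∫ x, ‖h x‖ ∂μ) / |w.im|)⁻¹ := by
      rw [← inv_pow]; ring
    rw [this]
    gcongr

end cauchyTransform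

/-- The closure in `L¹(μ)` of a division-invariant space `L` of entire functions is the kernel of
a unimodular function `g₀`, and `μ` has at least two atoms. -/
structure IsUnimodularKernel (μ : Measure ℝ) (L : Submodule ℂ (ℂ → ℂ)) (g₀ : ℝ → ℂ) : Prop where
  differentiable : ∀ F ∈ L, Differentiable ℂ F
  exists_div : ∀ F ∈ L, ∀ w : ℂ, F w = 0 → ∃ G ∈ L, ∀ z : ℂ, z ≠ w → G z = F z / (z - w)
  integrable : ∀ F ∈ L, Integrable (fun x : ℝ => F x) μ
  measurable : Measurable g₀
  norm_eq_one : ∀ᵐ x ∂μ, ‖g₀ x‖ = 1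
  integral_eq_zero : ∀ F ∈ L, ∫ x : ℝ, F x * g₀ x ∂μ = 0
  exists_approx : ∀ f : ℝ → ℂ, Integrable f μ → ∫ x, f x * g₀ x ∂μ = 0 → ∀ ε : ℝ, 0 < ε →
    ∃ F ∈ L, ∫ x : ℝ, ‖f x - F x‖ ∂μ < ε
  exists_atoms : ∃ a b : ℝ, a ≠ b ∧ 0 < μ.real {a} ∧ 0 < μ.real {b}

/-- The Cauchy transform of `F g₀ dμ`. -/
noncomputable def weightedTransform (μ : Measure ℝ) (g₀ : ℝ → ℂ) (F : ℂ → ℂ) (w : ℂ) : ℂ :=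
  cauchyTransform μ (fun x => F x * g₀ x) w

namespace IsUnimodularKernel

variable {μ : Measure ℝ} {L : Submodule ℂ (ℂ → ℂ)} {g₀ : ℝ → ℂ} (hL : IsUnimodularKernel μ L g₀)
include hL

lemma integrable_mul {f : ℝ → ℂ} (hf : Integrable f μ) :
    Integrable (fun x : ℝ => f x * g₀ x) μ :=
  hf.mul_bdd (c := 1) hL.measurable.aestronglyMeasurable (hL.norm_eq_one.mono fun _ h => h.le)

lemma integral_norm_mul (f : ℝ → ℂ) :
    ∫ x : ℝ, ‖f x * g₀ x‖ ∂μ = ∫ x : ℝ, ‖f x‖ ∂μ :=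
  integral_congr_ae (hL.norm_eq_one.mono fun x hx => by simp [hx])

lemma norm_weightedTransform_le {F : ℂ → ℂ} (hF : Integrable (fun x : ℝ => F x) μ) {w : ℂ}
    (hw : w.im ≠ 0) : ‖weightedTransform μ g₀ F w‖ ≤ (∫ x : ℝ, ‖F x‖ ∂μ) / |w.im| := by
  rw [← hL.integral_norm_mul]
  exact norm_cauchyTransform_le (hL.integrable_mul hF) hw

lemma weightedTransform_sub {F G : ℂ → ℂ} (hF : Integrable (fun x : ℝ => F x) μ)
    (hG : Integrable (fun x : ℝ => G x) μ) {w : ℂ} (hw : w.im ≠ 0) :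
    weightedTransform μ g₀ (F - G) w
      = weightedTransform μ g₀ F w - weightedTransform μ g₀ G w := by
  rw [weightedTransform, weightedTransform, weightedTransform,
    ← cauchyTransform_sub (hL.integrable_mul hF) (hL.integrable_mul hG) hw]
  simp only [Pi.sub_apply, sub_mul]

omit hL in
lemma weightedTransform_smul (c : ℂ) (F : ℂ → ℂ) (w : ℂ) :
    weightedTransform μ g₀ (c • F) w = c * weightedTransform μ g₀ F w := by
  rw [weightedTransform, weightedTransform, ← cauchyTransform_const_mul]
  simp only [Pi.smul_apply, smul_eq_mul, mul_assoc]

lemma weightedTransform_eq_zero {G : ℂ → ℂ} (hG : G ∈ L) {w : ℂ} (hw : w.im ≠ 0) (hGw : G w = 0) :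
    weightedTransform μ g₀ G w = 0 := by
  obtain ⟨K, hK, hKG⟩ := hL.exists_div G hG w hGw
  rw [weightedTransform, cauchyTransform, ← hL.integral_eq_zero K hK]
  refine integral_congr_ae (Eventually.of_forall fun x => ?_)
  have : (x : ℂ) ≠ w := sub_ne_zero.1 (ofReal_sub_ne_zero hw x)
  simp only [hKG _ this]
  ring

lemma mul_weightedTransform_comm {F G : ℂ → ℂ} (hF : F ∈ L) (hG : G ∈ L) {w : ℂ} (hw : w.im ≠ 0) :
    F w * weightedTransform μ g₀ G w = G w * weightedTransform μ g₀ F w := by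
  have h := hL.weightedTransform_eq_zero (L.sub_mem (L.smul_mem (F w) hG) (L.smul_mem (G w) hF)) hw
    (by simp [mul_comm])
  rw [hL.weightedTransform_sub ((hL.integrable G hG).smul (F w)) ((hL.integrable F hF).smul (G w)) hw,
    weightedTransform_smul, weightedTransform_smul] at h
  exact sub_eq_zero.1 h

lemma exists_weightedTransform_ne_zero {w : ℂ} (hw : w.im ≠ 0) :
    ∃ G ∈ L, weightedTransform μ g₀ G w ≠ 0 := by
  by_contra! hcon
  have hall : ∀ f : ℝ → ℂ, Integrable f μ → ∫ x, f x * g₀ x ∂μ = 0 →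
      cauchyTransform μ (fun x => f x * g₀ x) w = 0 := by
    intro f hf h0
    rw [← norm_le_zero_iff]
    refine le_of_forall_pos_le_add fun ε hε => ?_
    rw [zero_add]
    have hp := abs_pos.2 hw
    obtain ⟨F, hF, hFε⟩ := hL.exists_approx f hf h0 (ε * |w.im|) (by positivity)
    have h1 := cauchyTransform_sub (hL.integrable_mul hf) (hL.integrable_mul (hL.integrable F hF)) hw
    have h2 : cauchyTransform μ (fun x : ℝ => F x * g₀ x) w = 0 := hcon F hF
    rw [h2, sub_zero] at h1
    rw [← h1]
    simp only [← sub_mul]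
    have hfF := hf.sub (hL.integrable F hF)
    refine (norm_cauchyTransform_le (hL.integrable_mul hfF) hw).trans ?_
    rw [div_le_iff₀ hp, hL.integral_norm_mul]
    exact hFε.le
  obtain ⟨a, b, hab, ha, hb⟩ := hL.exists_atoms
  have hg : ∀ c : ℝ, 0 < μ.real {c} → g₀ c ≠ 0 := by
    intro c hc h0
    have h1 := hL.norm_eq_one
    rw [ae_iff] at h1
    have h2 : μ {c} ≤ 0 := by
      rw [← h1]
      refine measure_mono ?_
      rintro _ rfl
      simp [h0]
    rw [measureReal_def, le_zero_iff.1 h2] at hc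
    simp at hc
  have hfin : ∀ c : ℝ, 0 < μ.real {c} → μ {c} ≠ ⊤ := by
    intro c hc h
    simp [measureReal_def, h] at hc
  have hint : ∀ c : ℝ, 0 < μ.real {c} → ∀ k : ℝ → ℂ, Integrable (({c} : Set ℝ).indicator k) μ := by
    intro c hc k
    rw [integrable_indicator_iff (measurableSet_singleton c)]
    exact integrableOn_singleton (hx := (hfin c hc).lt_top)
  set α : ℂ := 1 / (μ.real {a} * g₀ a) with hα
  set β : ℂ := -1 / (μ.real {b} * g₀ b) with hβ
  set f : ℝ → ℂ := fun x => ({a} : Set ℝ).indicator (fun _ => α) x +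
    ({b} : Set ℝ).indicator (fun _ => β) x with hf
  have hfk : ∀ k : ℝ → ℂ, ∫ x, f x * k x ∂μ =
      μ.real {a} * (α * k a) + μ.real {b} * (β * k b) := by
    intro k
    have h1 : ∀ x, f x * k x = ({a} : Set ℝ).indicator (fun x => α * k x) x +
        ({b} : Set ℝ).indicator (fun x => β * k x) x := by
      intro x
      simp only [hf, add_mul, Set.indicator_mul_left]
    simp only [h1]
    rw [integral_add (hint a ha _) (hint b hb _), integral_indicator (measurableSet_singleton a),
      integral_indicator (measurableSet_singleton b), integral_singleton, integral_singleton]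
    simp
  have ha' : (μ.real {a} : ℂ) ≠ 0 := by exact_mod_cast ha.ne'
  have hb' : (μ.real {b} : ℂ) ≠ 0 := by exact_mod_cast hb.ne'
  have h1 := hall f ((hint a ha _).add (hint b hb _)) (by
    rw [hfk, hα, hβ]
    have := hg a ha
    have := hg b hb
    field_simp
    ring)
  simp only [cauchyTransform, mul_div_assoc] at h1
  rw [hfk (fun x => g₀ x / ((x : ℂ) - w)), hα, hβ] at h1
  have e1 := ofReal_sub_ne_zero hw a
  have e2 := ofReal_sub_ne_zero hw b
  have e3 := hg a ha
  have e4 := hg b hb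
  field_simp at h1
  apply hab
  have : (a : ℂ) = b := by linear_combination -h1
  exact_mod_cast this

lemma exists_apply_ne_zero (w : ℂ) : ∃ G ∈ L, G w ≠ 0 := by
  have key : ∀ n : ℕ, ∀ F ∈ L, analyticOrderAt F w = n → ∃ G ∈ L, G w ≠ 0 := by
    intro n
    induction n with
    | zero =>
      intro F hF h
      exact ⟨F, hF, ((hL.differentiable F hF).analyticAt w).analyticOrderAt_eq_zero.1 (by simpa using h)⟩
    | succ n ih =>
      intro F hF h
      have hFa := (hL.differentiable F hF).analyticAt w
      have hF0 : F w = 0 := by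
        by_contra h0
        rw [hFa.analyticOrderAt_eq_zero.2 h0] at h
        norm_cast at h
      obtain ⟨K, hK, hKF⟩ := hL.exists_div F hF w hF0
      refine ih K hK ?_
      have hFK : F = (fun z => z - w) * K := by
        ext z
        rcases eq_or_ne z w with rfl | hz
        · simp [hF0]
        · rw [Pi.mul_apply, hKF z hz, mul_div_cancel₀ _ (sub_ne_zero.2 hz)]
      have hid : analyticOrderAt (fun z : ℂ => z - w) w = 1 := analyticOrderAt_id_sub_const_self
      rw [hFK, analyticOrderAt_mul (by fun_prop) ((hL.differentiable K hK).analyticAt w), hid,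
        Nat.cast_add, Nat.cast_one, add_comm] at h
      exact (ENat.add_left_injective_of_ne_top ENat.one_ne_top) h
  obtain ⟨F, hF, hFw⟩ := hL.exists_weightedTransform_ne_zero (w := Complex.I) (by simp)
  have hFI : F Complex.I ≠ 0 := fun h =>
    hFw (hL.weightedTransform_eq_zero hF (by simp) h)
  have hne : analyticOrderAt F w ≠ ⊤ := by
    intro h
    rw [analyticOrderAt_eq_top] at h
    have han : AnalyticOnNhd ℂ F Set.univ := fun z _ => (hL.differentiable F hF).analyticAt z
    have := han.eqOn_zero_of_preconnected_of_eventuallyEq_zero isPreconnected_univ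
      (Set.mem_univ w) h (Set.mem_univ Complex.I)
    exact hFI this
  obtain ⟨n, hn⟩ := ENat.ne_top_iff_exists.1 hne
  exact key n F hF hn.symm

lemma L1Majorant_le {G : ℂ → ℂ} (hG : G ∈ L) {w : ℂ} (hw : w.im ≠ 0)
    (hGw : weightedTransform μ g₀ G w ≠ 0) :
    L1Majorant μ L w ≤ ENNReal.ofReal (‖G w‖ / (‖weightedTransform μ g₀ G w‖ * |w.im|)) := by
  refine iSup_le fun ⟨F, hF, hF1⟩ => ?_
  have hint := hL.integrable F hF
  have h1 : ∫ x : ℝ, ‖F x‖ ∂μ ≤ 1 := by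
    rw [integral_norm_eq_lintegral_enorm hint.aestronglyMeasurable]
    exact ENNReal.toReal_le_of_le_ofReal zero_le_one (by rw [ENNReal.ofReal_one]; exact hF1)
  have h2 := hL.mul_weightedTransform_comm hF hG hw
  have h3 := hL.norm_weightedTransform_le hint hw
  have hp := abs_pos.2 hw
  have hq := norm_pos_iff.2 hGw
  show ‖F w‖ₑ ≤ _
  rw [← ofReal_norm]
  refine ENNReal.ofReal_le_ofReal ?_
  rw [le_div_iff₀ (by positivity), ← mul_assoc, ← norm_mul, h2, norm_mul, mul_assoc]
  refine mul_le_of_le_one_right (norm_nonneg _) ?_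
  rw [← le_div_iff₀ hp]
  exact h3.trans (by gcongr)

end IsUnimodularKernel

lemma DifferentiableOn.conj_conj_sideHalf {D : ℂ → ℂ} {s : ℝ}
    (hD : DifferentiableOn ℂ D (sideHalf (-s))) :
    DifferentiableOn ℂ (fun z => (starRingEnd ℂ) (D ((starRingEnd ℂ) z))) (sideHalf s) := by
  intro z hz
  have hz' : (starRingEnd ℂ) z ∈ sideHalf (-s) := by simpa [sideHalf] using hz
  have := ((hD _ hz').differentiableAt ((isOpen_sideHalf _).mem_nhds hz')).conj_conj
  rw [starRingEnd_self_apply] at this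
  exact this.differentiableWithinAt

lemma isPreconnected_sideHalf (s : ℝ) : IsPreconnected (sideHalf s) := by
  refine Convex.isPreconnected ?_
  intro x hx y hy a b ha hb hab
  have hx' : 0 < s * x.im := hx
  have hy' : 0 < s * y.im := hy
  show 0 < s * (a • x + b • y).im
  simp only [Complex.add_im, Complex.smul_im, smul_eq_mul]
  have e : s * (a * x.im + b * y.im) = a * (s * x.im) + b * (s * y.im) := by ring
  rw [e]
  rcases ha.eq_or_lt with rfl | ha
  · have : b = 1 := by linarith
    subst this; simpa using hy'
  · have := mul_pos ha hx'
    have := mul_nonneg hb hy'.le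
    linarith

/-- Nontrivial holomorphic functions on a half-plane have a nontrivial product. -/
lemma exists_mul_ne_zero_of_sideHalf {f g : ℂ → ℂ} {s : ℝ} (hf : DifferentiableOn ℂ f (sideHalf s))
    (hg : DifferentiableOn ℂ g (sideHalf s)) (hf0 : ∃ z ∈ sideHalf s, f z ≠ 0)
    (hg0 : ∃ z ∈ sideHalf s, g z ≠ 0) : ∃ z ∈ sideHalf s, f z * g z ≠ 0 := by
  by_contra! h
  have := AnalyticOnNhd.eq_zero_or_eq_zero_of_mul_eq_zero
    (hf.analyticOnNhd (isOpen_sideHalf s)) (hg.analyticOnNhd (isOpen_sideHalf s)) h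
    (isPreconnected_sideHalf s)
  obtain ⟨z, hz, hfz⟩ := hf0
  obtain ⟨w, hw, hgw⟩ := hg0
  rcases this with h1 | h1
  · exact hfz (h1 z hz)
  · exact hgw (h1 w hw)

/-- An entire function which is of bounded type in both half-planes and which decays along the
imaginary axis vanishes. -/
lemma eq_zero_of_bounded_type_of_decay {Q : ℂ → ℂ} (hQ : Differentiable ℂ Q)
    (hD : ∀ s : ℝ, |s| = 1 → ∃ (D : ℂ → ℂ) (B : ℝ), DifferentiableOn ℂ D (sideHalf s) ∧
      (∀ z ∈ sideHalf s, ‖D z‖ ≤ 1) ∧ (∃ z ∈ sideHalf s, D z ≠ 0) ∧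
      ∀ z ∈ sideHalf s, ‖Q z * D z‖ ≤ B)
    {C : ℝ} (hC : ∀ y : ℝ, ‖Q (y * Complex.I)‖ ≤ C)
    (h0 : Tendsto (fun y : ℝ => Q (y * Complex.I)) atTop (nhds 0)) : ∀ z, Q z = 0 := by
  obtain ⟨D₁, B₁, hd₁, h₁, hn₁, hb₁⟩ := hD 1 (by simp)
  obtain ⟨D₂, B₂, hd₂, h₂, hn₂, hb₂⟩ := hD (-1) (by simp)
  have hcj : ∀ z ∈ sideHalf 1, (starRingEnd ℂ) z ∈ sideHalf (-1) := fun z hz => by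
    simpa [sideHalf] using hz
  have hcj' : ∀ z ∈ sideHalf (-1), (starRingEnd ℂ) z ∈ sideHalf 1 := fun z hz => by
    simpa [sideHalf] using hz
  have hQc : Differentiable ℂ fun z => (starRingEnd ℂ) (Q ((starRingEnd ℂ) z)) := by
    intro z
    have := (hQ ((starRingEnd ℂ) z)).conj_conj
    rwa [starRingEnd_self_apply] at this
  have hB1 : 0 ≤ B₁ := by
    obtain ⟨z, hz, -⟩ := hn₁
    exact (norm_nonneg _).trans (hb₁ z hz)
  have hC0 : 0 ≤ C := (norm_nonneg _).trans (hC 0)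
  have hn : ∀ z, ‖(starRingEnd ℂ) z‖ = ‖z‖ := fun z => by simp
  have hW := eq_zero_of_upper_bounded_type
    (W := fun z => Q z * (starRingEnd ℂ) (Q ((starRingEnd ℂ) z)))
    (E := fun z => D₁ z * (starRingEnd ℂ) (D₂ ((starRingEnd ℂ) z))) (B := B₁ * B₂) (C := C * C)
    (hQ.mul hQc) ?_ (hd₁.mul hd₂.conj_conj_sideHalf) ?_ ?_ ?_ ?_ ?_
  · have := AnalyticOnNhd.eq_zero_or_eq_zero_of_mul_eq_zero (U := Set.univ)
      (fun z _ => hQ.analyticAt z) (fun z _ => hQc.analyticAt z) (fun z _ => hW z)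
      isPreconnected_univ
    rcases this with h | h
    · exact fun z => h z trivial
    · intro z
      have := h ((starRingEnd ℂ) z) trivial
      simpa using this
  · intro z
    simp only [starRingEnd_self_apply, norm_mul, hn, mul_comm]
  · intro z hz
    rw [norm_mul, hn]
    exact mul_le_one₀ (h₁ z hz) (norm_nonneg _) (h₂ _ (hcj z hz))
  · refine exists_mul_ne_zero_of_sideHalf hd₁ hd₂.conj_conj_sideHalf hn₁ ?_
    obtain ⟨z, hz, hz0⟩ := hn₂
    exact ⟨_, hcj' z hz, by simpa using hz0⟩
  · intro z hz
    have e : Q z * (starRingEnd ℂ) (Q ((starRingEnd ℂ) z)) *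
        (D₁ z * (starRingEnd ℂ) (D₂ ((starRingEnd ℂ) z))) =
        (Q z * D₁ z) * (starRingEnd ℂ) (Q ((starRingEnd ℂ) z) * D₂ ((starRingEnd ℂ) z)) := by
      rw [map_mul]; ring
    rw [e, norm_mul, hn]
    exact mul_le_mul (hb₁ z hz) (hb₂ _ (hcj z hz)) (norm_nonneg _) hB1
  · intro y
    rw [norm_mul, hn]
    refine mul_le_mul (hC y) ?_ (norm_nonneg _) hC0
    have := hC (-y)
    simpa using this
  · refine tendsto_zero_iff_norm_tendsto_zero.2 ?_
    refine squeeze_zero (g := fun y : ℝ => ‖Q (y * Complex.I)‖ * C) (fun _ => norm_nonneg _) ?_ ?_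
    · intro y
      rw [norm_mul, hn]
      gcongr
      have := hC (-y)
      simpa using this
    · simpa using (tendsto_zero_iff_norm_tendsto_zero.1 h0).mul_const C

/-- Integrals of entire functions depending on a parameter are holomorphic. -/
lemma differentiableAt_integral_of_dominated {μ : Measure ℝ} {H : ℂ → ℝ → ℂ} {w₀ : ℂ}
    {bound : ℝ → ℝ} (hH : ∀ x, Differentiable ℂ fun w => H w x)
    (hm : ∀ w, AEStronglyMeasurable (H w) μ) (hb : Integrable bound μ)
    (hle : ∀ w ∈ Metric.closedBall w₀ 2, ∀ x, ‖H w x‖ ≤ bound x) :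
    DifferentiableAt ℂ (fun w => ∫ x, H w x ∂μ) w₀ := by
  have hd : ∀ w ∈ Metric.ball w₀ 1, ∀ x, ‖deriv (fun w => H w x) w‖ ≤ bound x := by
    intro w hw x
    have := Complex.norm_deriv_le_of_forall_mem_sphere_norm_le (f := fun w => H w x) (c := w)
      (C := bound x) one_pos ((hH x).diffContOnCl) (fun z hz => hle z (by
        rw [Metric.mem_closedBall]
        rw [Metric.mem_sphere] at hz
        rw [Metric.mem_ball] at hw
        have := dist_triangle z w w₀
        linarith) x)
    simpa using this
  have hmd : AEStronglyMeasurable (fun x => deriv (fun w => H w x) w₀) μ := by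
    obtain ⟨v, hv⟩ : ∃ v : ℕ → ℂ, Tendsto v atTop (nhdsWithin 0 {0}ᶜ) :=
      exists_seq_tendsto _
    refine aestronglyMeasurable_of_tendsto_ae (u := atTop)
      (f := fun n x => (v n)⁻¹ • (H (w₀ + v n) x - H w₀ x)) (fun n => ?_) ?_
    · exact ((hm (w₀ + v n)).sub (hm w₀)).const_smul (v n)⁻¹
    · refine Eventually.of_forall fun x => ?_
      have := hasDerivAt_iff_tendsto_slope_zero.1 (hH x w₀).hasDerivAt
      exact this.comp hv
  have key := hasDerivAt_integral_of_dominated_loc_of_deriv_le (μ := μ) (𝕜 := ℂ)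
    (F := H) (F' := fun w x => deriv (fun w => H w x) w) (x₀ := w₀) (bound := bound)
    (Metric.ball_mem_nhds w₀ one_pos) (Eventually.of_forall hm)
    (hb.mono' (hm w₀) (Eventually.of_forall fun x => hle w₀ (by simp) x)) hmd
    (Eventually.of_forall fun x w hw => hd w hw x) hb
    (Eventually.of_forall fun x w _ => (hH x w).hasDerivAt)
  exact key.2.differentiableAt

lemma upperHalf_eq : UpperHalf = sideHalf 1 := by
  ext z; simp [UpperHalf, sideHalf]

lemma lowerHalf_eq : LowerHalf = sideHalf (-1) := by
  ext z; simp [LowerHalf, sideHalf]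

lemma dense_im_ne_zero : Dense {w : ℂ | w.im ≠ 0} :=
  Measure.dense_of_ae (μ := (volume : Measure ℂ)) ae_im_ne_zero

lemma norm_dslope_le {f : ℂ → ℂ} (hf : Differentiable ℂ f) {S : Set ℂ} (hS : Convex ℝ S) {M : ℝ}
    (hM : ∀ z ∈ S, ‖deriv f z‖ ≤ M) {a b : ℂ} (ha : a ∈ S) (hb : b ∈ S) : ‖dslope f a b‖ ≤ M := by
  rcases eq_or_ne b a with rfl | hab
  · rw [dslope_same]
    exact hM b hb
  · rw [dslope_of_ne _ hab, slope_def_field, norm_div,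
      div_le_iff₀ (norm_pos_iff.2 (sub_ne_zero.2 hab))]
    exact hS.norm_image_sub_le_of_norm_deriv_le (fun z _ => hf z) hM ha hb

lemma dslope_comm (f : ℂ → ℂ) (a b : ℂ) : dslope f a b = dslope f b a := by
  rcases eq_or_ne b a with rfl | hab
  · rfl
  · rw [dslope_of_ne _ hab, dslope_of_ne _ hab.symm, slope_comm]

lemma differentiable_dslope {f : ℂ → ℂ} (hf : Differentiable ℂ f) (a : ℂ) :
    Differentiable ℂ (dslope f a) := by
  rw [← differentiableOn_univ]
  exact (Complex.differentiableOn_dslope univ_mem).2 hf.differentiableOn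

/-- The kernel of the integral representation of `F 𝒞(G) - G 𝒞(F)`. -/
noncomputable def crossKernel (F G : ℂ → ℂ) (w x : ℂ) : ℂ :=
  F x * dslope G x w - G x * dslope F x w

lemma crossKernel_of_ne (F G : ℂ → ℂ) {w x : ℂ} (h : x ≠ w) :
    crossKernel F G w x = F w * (G x / (x - w)) - G w * (F x / (x - w)) := by
  have h1 : x - w ≠ 0 := sub_ne_zero.2 h
  have h2 : w - x ≠ 0 := sub_ne_zero.2 h.symm
  rw [crossKernel, dslope_of_ne _ h.symm, dslope_of_ne _ h.symm, slope_def_field, slope_def_field,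
    ← neg_sub x w]
  field_simp
  ring

lemma exists_norm_crossKernel_le {F G : ℂ → ℂ} (hF : Differentiable ℂ F) (hG : Differentiable ℂ G)
    (w₀ : ℂ) : ∃ M : ℝ, ∀ w ∈ Metric.closedBall w₀ 2, ∀ x : ℂ,
      ‖crossKernel F G w x‖ ≤ M * (‖F x‖ + ‖G x‖) := by
  have hb : ∀ f : ℂ → ℂ, Continuous f → ∃ M, ∀ z ∈ Metric.closedBall w₀ 4, ‖f z‖ ≤ M := fun f hf =>
    (isCompact_closedBall w₀ 4).exists_bound_of_continuousOn hf.continuousOn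
  have hdc : ∀ f : ℂ → ℂ, Differentiable ℂ f → Continuous (deriv f) := fun f hf =>
    hf.contDiff.continuous_deriv le_top
  obtain ⟨M₁, h₁⟩ := hb F hF.continuous
  obtain ⟨M₂, h₂⟩ := hb G hG.continuous
  obtain ⟨M₃, h₃⟩ := hb _ (hdc F hF)
  obtain ⟨M₄, h₄⟩ := hb _ (hdc G hG)
  set M := max (max M₁ M₂) (max M₃ M₄)
  have hM₁ : M₁ ≤ M := (le_max_left _ _).trans (le_max_left _ _)
  have hM₂ : M₂ ≤ M := (le_max_right _ _).trans (le_max_left _ _)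
  have hM₃ : M₃ ≤ M := (le_max_left _ _).trans (le_max_right _ _)
  have hM₄ : M₄ ≤ M := (le_max_right _ _).trans (le_max_right _ _)
  have hM : 0 ≤ M := (norm_nonneg _).trans ((h₁ w₀ (by simp)).trans hM₁)
  refine ⟨M, fun w hw x => ?_⟩
  have hw4 : w ∈ Metric.closedBall w₀ 4 := Metric.closedBall_subset_closedBall (by norm_num) hw
  have hconv := convex_closedBall w₀ 4
  by_cases hx : x ∈ Metric.closedBall w₀ 4
  · have e1 := norm_dslope_le hF hconv (fun z hz => (h₃ z hz).trans hM₃) hx hw4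
    have e2 := norm_dslope_le hG hconv (fun z hz => (h₄ z hz).trans hM₄) hx hw4
    calc ‖crossKernel F G w x‖ ≤ ‖F x‖ * ‖dslope G x w‖ + ‖G x‖ * ‖dslope F x w‖ := by
          rw [crossKernel, ← norm_mul, ← norm_mul]
          exact norm_sub_le _ _
      _ ≤ ‖F x‖ * M + ‖G x‖ * M := by gcongr
      _ = _ := by ring
  · have hd : 1 ≤ ‖x - w‖ := by
      rw [Metric.mem_closedBall, not_le] at hx
      rw [Metric.mem_closedBall] at hw
      have := dist_triangle x w w₀
      rw [← dist_eq_norm]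
      linarith
    have hne : x ≠ w := by
      rintro rfl
      simp at hd
      linarith
    have hdiv : ∀ a : ℂ, ‖a / (x - w)‖ ≤ ‖a‖ := fun a => by
      rw [norm_div]
      exact div_le_self (norm_nonneg _) hd
    have e1 := (h₁ w hw4).trans hM₁
    have e2 := (h₂ w hw4).trans hM₂
    calc ‖crossKernel F G w x‖ ≤ ‖F w‖ * ‖G x / (x - w)‖ + ‖G w‖ * ‖F x / (x - w)‖ := by
          rw [crossKernel_of_ne F G hne, ← norm_mul, ← norm_mul]
          exact norm_sub_le _ _
      _ ≤ M * ‖G x‖ + M * ‖F x‖ := by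
          gcongr
          · exact hdiv _
          · exact hdiv _
      _ = _ := by ring

/-- The set of nonzeros of a nonzero entire function is dense. -/
lemma dense_ne_zero_of_differentiable {f : ℂ → ℂ} (hf : Differentiable ℂ f) (h0 : f ≠ 0) :
    Dense {z | f z ≠ 0} := by
  change Dense {z | f z = 0}ᶜ
  rw [← interior_eq_empty_iff_dense_compl, Set.eq_empty_iff_forall_notMem]
  intro z hz
  apply h0
  have han : AnalyticOnNhd ℂ f Set.univ := fun z _ => hf.analyticAt z
  have := han.eqOn_zero_of_preconnected_of_eventuallyEq_zero isPreconnected_univ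
    (Set.mem_univ z) (mem_interior_iff_mem_nhds.1 hz)
  ext w
  exact this (Set.mem_univ w)

namespace IsUnimodularKernel

variable {μ : Measure ℝ} {L : Submodule ℂ (ℂ → ℂ)} {g₀ : ℝ → ℂ} (hL : IsUnimodularKernel μ L g₀)
include hL

lemma differentiable_integral_crossKernel {F G : ℂ → ℂ} (hF : Differentiable ℂ F)
    (hG : Differentiable ℂ G) (hFi : Integrable (fun x : ℝ => F x) μ)
    (hGi : Integrable (fun x : ℝ => G x) μ) :
    Differentiable ℂ fun w => ∫ x : ℝ, crossKernel F G w x * g₀ x ∂μ := by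
  intro w₀
  obtain ⟨M, hM⟩ := exists_norm_crossKernel_le hF hG w₀
  refine differentiableAt_integral_of_dominated
    (bound := fun x : ℝ => M * (‖F x * g₀ x‖ + ‖G x * g₀ x‖)) (fun x => ?_) (fun w => ?_) ?_ ?_
  · exact (((differentiable_dslope hG _).const_mul _).sub
      ((differentiable_dslope hF _).const_mul _)).mul_const _
  · refine AEStronglyMeasurable.mul (Continuous.aestronglyMeasurable ?_)
      hL.measurable.aestronglyMeasurable
    simp only [crossKernel, dslope_comm _ _ w]
    have h1 := (differentiable_dslope hG w).continuous
    have h2 := (differentiable_dslope hF w).continuous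
    have h3 := hF.continuous
    have h4 := hG.continuous
    fun_prop
  · exact (((hL.integrable_mul hFi).norm).add ((hL.integrable_mul hGi).norm)).const_mul M
  · intro w hw x
    have := hM w hw x
    simp only [norm_mul, ← add_mul, ← mul_assoc]
    gcongr

lemma integral_crossKernel {F G : ℂ → ℂ} (hFi : Integrable (fun x : ℝ => F x) μ)
    (hGi : Integrable (fun x : ℝ => G x) μ) {w : ℂ} (hw : w.im ≠ 0) :
    ∫ x : ℝ, crossKernel F G w x * g₀ x ∂μ
      = F w * weightedTransform μ g₀ G w - G w * weightedTransform μ g₀ F w := by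
  rw [weightedTransform, weightedTransform, cauchyTransform, cauchyTransform,
    ← integral_const_mul, ← integral_const_mul, ← integral_sub
    ((integrable_div_ofReal_sub (hL.integrable_mul hGi) hw).const_mul _)
    ((integrable_div_ofReal_sub (hL.integrable_mul hFi) hw).const_mul _)]
  refine integral_congr_ae (Eventually.of_forall fun x => ?_)
  have : (x : ℂ) ≠ w := sub_ne_zero.1 (ofReal_sub_ne_zero hw x)
  simp only [crossKernel_of_ne F G this]
  ring

lemma exists_entire_quotient {P : (ℂ → ℂ) → ℂ → ℂ} (hP : ∀ G ∈ L, Differentiable ℂ (P G))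
    (hcomm : ∀ G ∈ L, ∀ K ∈ L, ∀ w : ℂ, w.im ≠ 0 → P G w * K w = P K w * G w) :
    ∃ Q : ℂ → ℂ, Differentiable ℂ Q ∧ ∀ G ∈ L, ∀ w, Q w * G w = P G w := by
  have hcomm' : ∀ G ∈ L, ∀ K ∈ L, ∀ w : ℂ, P G w * K w = P K w * G w := by
    intro G hG K hK w
    have := Continuous.ext_on dense_im_ne_zero
      ((hP G hG).mul (hL.differentiable K hK)).continuous
      ((hP K hK).mul (hL.differentiable G hG)).continuous (fun w hw => hcomm G hG K hK w hw)
    exact congrFun this w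
  choose H hH hH0 using hL.exists_apply_ne_zero
  have hQ : ∀ G ∈ L, ∀ w, P (H w) w / H w w * G w = P G w := by
    intro G hG w
    have := hH0 w
    rw [div_mul_eq_mul_div, div_eq_iff this]
    exact hcomm' _ (hH w) _ hG w
  refine ⟨fun w => P (H w) w / H w w, fun w₀ => ?_, hQ⟩
  have h1 : ∀ᶠ w in nhds w₀, H w₀ w ≠ 0 :=
    (hL.differentiable _ (hH w₀)).continuous.continuousAt.eventually_ne (hH0 w₀)
  have h2 : (fun w => P (H w) w / H w w) =ᶠ[nhds w₀] fun w => P (H w₀) w / H w₀ w := by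
    filter_upwards [h1] with w hw
    rw [eq_div_iff hw]
    exact hQ _ (hH w₀) w
  rw [h2.differentiableAt_iff]
  exact ((hP _ (hH w₀)) w₀).div ((hL.differentiable _ (hH w₀)) w₀) (hH0 w₀)

lemma exists_bounded_of_bddTypeQuot {F F₀ Q : ℂ → ℂ}
    (hF : Integrable (fun x : ℝ => F x) μ) (hF₀ : F₀ ∈ L) (hF₀0 : F₀ ≠ 0)
    (hQ : Differentiable ℂ Q) (hQF : ∀ w : ℂ, w.im ≠ 0 →
      Q w * F₀ w = F w * weightedTransform μ g₀ F₀ w - F₀ w * weightedTransform μ g₀ F w)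
    {s : ℝ} (hs : |s| = 1) (hb : BddTypeQuot (sideHalf s) F F₀) :
    ∃ (D : ℂ → ℂ) (B : ℝ), DifferentiableOn ℂ D (sideHalf s) ∧
      (∀ z ∈ sideHalf s, ‖D z‖ ≤ 1) ∧ (∃ z ∈ sideHalf s, D z ≠ 0) ∧
      ∀ z ∈ sideHalf s, ‖Q z * D z‖ ≤ B := by
  obtain ⟨g₁, g₂, hd₁, hd₂, ⟨C₁, hC₁⟩, ⟨C₂, hC₂⟩, hne, hgg⟩ := hb
  obtain ⟨D₁, hD₁, h₁⟩ := exists_bounded_quotient_cauchyTransform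
    (hL.integrable_mul (hL.integrable F₀ hF₀)) hs
  obtain ⟨D₂, hD₂, h₂⟩ := exists_bounded_quotient_cauchyTransform (hL.integrable_mul hF) hs
  have hsI : (s : ℂ) * Complex.I ∈ sideHalf s := by
    have : 0 < s * s := by rw [← abs_mul_abs_self, hs]; norm_num
    simpa [sideHalf] using this
  set C := max (max C₁ C₂) 1
  have hC : 0 < C := one_pos.trans_le (le_max_right _ _)
  have hCC₁ : C₁ ≤ C := (le_max_left _ _).trans (le_max_left _ _)
  have hCC₂ : C₂ ≤ C := (le_max_right _ _).trans (le_max_left _ _)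
  have hpos : ∀ D : ℂ → ℂ, ∀ h : ℝ → ℂ, ∀ w : ℂ,
      ((1 + (∫ x, ‖h x‖ ∂μ) / |w.im|) ^ 4)⁻¹ ≤ ‖D w‖ → D w ≠ 0 := by
    intro D h w hw
    rw [← norm_pos_iff]
    refine lt_of_lt_of_le ?_ hw
    positivity
  have hDd : DifferentiableOn ℂ (fun z => (C : ℂ)⁻¹ * (g₂ z * (D₁ z * D₂ z))) (sideHalf s) :=
    (hd₂.mul (hD₁.mul hD₂)).const_mul _
  have hnC : ‖((C : ℂ)⁻¹)‖ = C⁻¹ := by simp [abs_of_pos hC]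
  refine ⟨fun z => (C : ℂ)⁻¹ * (g₂ z * (D₁ z * D₂ z)), 16, hDd, fun z hz => ?_, ?_, ?_⟩
  · rw [norm_mul, norm_mul, norm_mul, hnC]
    calc C⁻¹ * (‖g₂ z‖ * (‖D₁ z‖ * ‖D₂ z‖)) ≤ C⁻¹ * (C * (1 * 1)) := by
          gcongr
          · exact (hC₂ z hz).trans hCC₂
          · exact (h₁ z hz).1
          · exact (h₂ z hz).1
      _ = 1 := by field_simp
  · push Not at hne
    obtain ⟨z, hz, h⟩ := exists_mul_ne_zero_of_sideHalf hd₂ (hD₁.mul hD₂) hne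
      (exists_mul_ne_zero_of_sideHalf hD₁ hD₂
        ⟨_, hsI, hpos _ _ _ (h₁ _ hsI).2.2⟩ ⟨_, hsI, hpos _ _ _ (h₂ _ hsI).2.2⟩)
    exact ⟨z, hz, mul_ne_zero (inv_ne_zero (by exact_mod_cast hC.ne')) h⟩
  · by_contra! hcon
    obtain ⟨z, hz, hlt⟩ := hcon
    have hcont : ContinuousAt (fun z => ‖Q z * ((C : ℂ)⁻¹ * (g₂ z * (D₁ z * D₂ z)))‖) z :=
      (hQ.continuous.continuousAt.mul
        (hDd.continuousOn.continuousAt ((isOpen_sideHalf s).mem_nhds hz))).norm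
    have hev := (hcont.eventually (lt_mem_nhds hlt)).and ((isOpen_sideHalf s).mem_nhds hz)
    obtain ⟨v, hv0, hv, hvs⟩ :=
      ((dense_ne_zero_of_differentiable (hL.differentiable _ hF₀) hF₀0).inter_nhds_nonempty hev)
    have hvi := sideHalf_im_ne_zero hvs
    have e : Q v * ((C : ℂ)⁻¹ * (g₂ v * (D₁ v * D₂ v))) =
        (C : ℂ)⁻¹ * (g₁ v * (D₁ v * weightedTransform μ g₀ F₀ v) * D₂ v -
          g₂ v * (D₂ v * weightedTransform μ g₀ F v) * D₁ v) := by
      apply mul_left_cancel₀ hv0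
      linear_combination (C : ℂ)⁻¹ * g₂ v * D₁ v * D₂ v * hQF v hvi +
        (C : ℂ)⁻¹ * D₁ v * D₂ v * weightedTransform μ g₀ F₀ v * hgg v hvs
    rw [e] at hv
    refine absurd hv (not_lt.2 ?_)
    have t : ∀ a b c : ℂ, ‖a‖ ≤ C → ‖b‖ ≤ 8 → ‖c‖ ≤ 1 → ‖a * b * c‖ ≤ C * 8 := by
      intro a b c ha hb hc
      rw [norm_mul, norm_mul]
      calc ‖a‖ * ‖b‖ * ‖c‖ ≤ C * 8 * 1 := by gcongr
        _ = _ := mul_one _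
    have t1 := t _ _ _ ((hC₁ v hvs).trans hCC₁) (h₁ v hvs).2.1 (h₂ v hvs).1
    have t2 := t _ _ _ ((hC₂ v hvs).trans hCC₂) (h₂ v hvs).2.1 (h₁ v hvs).1
    rw [norm_mul, hnC]
    calc _ ≤ C⁻¹ * (C * 8 + C * 8) := by
          gcongr
          exact (norm_sub_le _ _).trans (add_le_add t1 t2)
      _ = 16 := by field_simp; norm_num

end IsUnimodularKernel

lemma exists_bound_of_eventually_le {f : ℝ → ℂ} (hf : Continuous f) {K : ℝ}
    (h : ∀ᶠ y : ℝ in atTop ⊔ atBot, ‖f y‖ ≤ K) : ∃ C, ∀ y, ‖f y‖ ≤ C := by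
  rw [eventually_sup, eventually_atTop, eventually_atBot] at h
  obtain ⟨⟨a, ha⟩, b, hb⟩ := h
  obtain ⟨C, hC⟩ := (isCompact_Icc (a := b) (b := a)).exists_bound_of_continuousOn hf.continuousOn
  refine ⟨max C K, fun y => ?_⟩
  rcases le_total a y with h1 | h1
  · exact (ha y h1).trans (le_max_right _ _)
  rcases le_total y b with h2 | h2
  · exact (hb y h2).trans (le_max_right _ _)
  · exact (hC y ⟨h2, h1⟩).trans (le_max_left _ _)

lemma tendsto_zero_of_eventually_le_div {f : ℝ → ℂ} {K : ℝ}
    (h : ∀ᶠ y : ℝ in atTop ⊔ atBot, ‖f y‖ ≤ K / |y|) : Tendsto f (atTop ⊔ atBot) (nhds 0) := by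
  have h1 : Tendsto (fun y : ℝ => |y|) (atTop ⊔ atBot) atTop :=
    tendsto_abs_atTop_atTop.sup tendsto_abs_atBot_atTop
  exact squeeze_zero_norm' h (h1.const_div_atTop K)

lemma integrable_of_lintegral_lt_top {μ : Measure ℝ} {F : ℂ → ℂ} (hF : Differentiable ℂ F)
    (h : (∫⁻ x : ℝ, (‖F (x : ℂ)‖₊ : ℝ≥0∞) ∂μ) < ⊤) : Integrable (fun x : ℝ => F x) μ :=
  ⟨(hF.continuous.comp Complex.continuous_ofReal).aestronglyMeasurable, h⟩

namespace IsUnimodularKernel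

variable {μ : Measure ℝ} {L : Submodule ℂ (ℂ → ℂ)} {g₀ : ℝ → ℂ} (hL : IsUnimodularKernel μ L g₀)
include hL

/-- Members of `𝒦` satisfy the same reproducing relation as those of `L`. -/
lemma mul_weightedTransform_comm_of_memKcal {F : ℂ → ℂ} (hF : MemKcal μ L F) {G : ℂ → ℂ}
    (hG : G ∈ L) {w : ℂ} (hw : w.im ≠ 0) :
    F w * weightedTransform μ g₀ G w = G w * weightedTransform μ g₀ F w := by
  obtain ⟨hFd, hFi, ⟨C, hC⟩, F₀, hF₀, hF₀0, hup, hlow⟩ := hF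
  rw [upperHalf_eq] at hup
  rw [lowerHalf_eq] at hlow
  have hFi := integrable_of_lintegral_lt_top hFd hFi
  have hcross := fun (G : ℂ → ℂ) (hG : G ∈ L) (w : ℂ) (hw : w.im ≠ 0) =>
    hL.integral_crossKernel hFi (hL.integrable G hG) hw
  obtain ⟨Q, hQ, hQG⟩ := hL.exists_entire_quotient
    (P := fun G w => ∫ x : ℝ, crossKernel F G w x * g₀ x ∂μ)
    (fun G hG => hL.differentiable_integral_crossKernel hFd (hL.differentiable G hG) hFi
      (hL.integrable G hG)) (by
      intro G hG K hK w hw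
      simp only [hcross G hG w hw, hcross K hK w hw]
      linear_combination F w * hL.mul_weightedTransform_comm hK hG hw)
  have hQG' : ∀ G ∈ L, ∀ w : ℂ, w.im ≠ 0 →
      Q w * G w = F w * weightedTransform μ g₀ G w - G w * weightedTransform μ g₀ F w :=
    fun G hG w hw => (hQG G hG w).trans (hcross G hG w hw)
  have hgrow : ∀ᶠ y : ℝ in atTop ⊔ atBot,
      ‖Q (y * Complex.I)‖ ≤ (C + ∫ x : ℝ, ‖F x‖ ∂μ) / |y| := by
    have hne : ∀ᶠ y : ℝ in atTop ⊔ atBot, y ≠ 0 :=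
      eventually_sup.2 ⟨eventually_ne_atTop 0, eventually_ne_atBot 0⟩
    filter_upwards [hC, hne] with y hy hy0
    have hw : (y * Complex.I : ℂ).im ≠ 0 := by simpa using hy0
    have hyi : |(y * Complex.I : ℂ).im| = |y| := by simp
    obtain ⟨G, hG, hGw⟩ := hL.exists_weightedTransform_ne_zero hw
    have hG0 : G (y * Complex.I) ≠ 0 := fun h => hGw (hL.weightedTransform_eq_zero hG hw h)
    have hp := abs_pos.2 hy0
    have hGp := norm_pos_iff.2 hG0
    have hq := norm_pos_iff.2 hGw
    have h1 := hy.trans (mul_le_mul_right (hL.L1Majorant_le hG hw hGw) (C : ℝ≥0∞))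
    rw [hyi] at h1
    have h2 : ‖F (y * Complex.I)‖ ≤ C * (‖G (y * Complex.I)‖ /
        (‖weightedTransform μ g₀ G (y * Complex.I)‖ * |y|)) := by
      rw [← ENNReal.ofReal_le_ofReal_iff (by positivity), ENNReal.ofReal_mul C.coe_nonneg,
        ENNReal.ofReal_coe_nnreal, ofReal_norm]
      exact h1
    have h3 := hL.norm_weightedTransform_le hFi hw
    rw [hyi] at h3
    have h4 : ‖Q (y * Complex.I)‖ * ‖G (y * Complex.I)‖ ≤
        (C + ∫ x : ℝ, ‖F x‖ ∂μ) / |y| * ‖G (y * Complex.I)‖ := by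
      rw [← norm_mul, hQG' G hG _ hw]
      refine (norm_sub_le _ _).trans ?_
      rw [norm_mul, norm_mul]
      calc _ ≤ C * (‖G (y * Complex.I)‖ / (‖weightedTransform μ g₀ G (y * Complex.I)‖ * |y|)) *
              ‖weightedTransform μ g₀ G (y * Complex.I)‖ +
            ‖G (y * Complex.I)‖ * ((∫ x : ℝ, ‖F x‖ ∂μ) / |y|) := by gcongr
        _ = _ := by field_simp
    exact le_of_mul_le_mul_right h4 hGp
  have hK : ∀ᶠ y : ℝ in atTop ⊔ atBot, ‖Q (y * Complex.I)‖ ≤ 1 := by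
    have := (tendsto_zero_of_eventually_le_div hgrow).norm
    rw [norm_zero] at this
    exact this.eventually_le_const one_pos
  obtain ⟨K, hK⟩ := exists_bound_of_eventually_le (f := fun y : ℝ => Q (y * Complex.I))
    (hQ.continuous.comp (by fun_prop)) hK
  have hQ0 := eq_zero_of_bounded_type_of_decay hQ (fun s hs => by
    refine hL.exists_bounded_of_bddTypeQuot hFi hF₀ hF₀0 hQ (hQG' F₀ hF₀) hs ?_
    rcases eq_or_eq_neg_of_abs_eq hs with rfl | rfl
    · exact hup
    · exact hlow) hK ((tendsto_zero_of_eventually_le_div hgrow).mono_left le_sup_left)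
  have := hQG' G hG w hw
  rw [hQ0 w, zero_mul] at this
  exact sub_eq_zero.1 this.symm

end IsUnimodularKernel

/-- The entire functions in `L¹(μ)` which satisfy the reproducing relation with respect to `L`. -/
structure IsAssociated (μ : Measure ℝ) (L : Submodule ℂ (ℂ → ℂ)) (g₀ : ℝ → ℂ) (F : ℂ → ℂ) :
    Prop where
  differentiable : Differentiable ℂ F
  integrable : Integrable (fun x : ℝ => F x) μ
  comm : ∀ G ∈ L, ∀ w : ℂ, w.im ≠ 0 →
    F w * weightedTransform μ g₀ G w = G w * weightedTransform μ g₀ F w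

namespace IsUnimodularKernel

variable {μ : Measure ℝ} {L : Submodule ℂ (ℂ → ℂ)} {g₀ : ℝ → ℂ} (hL : IsUnimodularKernel μ L g₀)
include hL

lemma isAssociated_of_mem {F : ℂ → ℂ} (hF : F ∈ L) : IsAssociated μ L g₀ F where
  differentiable := hL.differentiable F hF
  integrable := hL.integrable F hF
  comm _ hG _ hw := hL.mul_weightedTransform_comm hF hG hw

lemma isAssociated_of_memKcal {F : ℂ → ℂ} (hF : MemKcal μ L F) : IsAssociated μ L g₀ F where
  differentiable := hF.1
  integrable := integrable_of_lintegral_lt_top hF.1 hF.2.1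
  comm _ hG _ hw := hL.mul_weightedTransform_comm_of_memKcal hF hG hw

omit hL in
lemma _root_.IsAssociated.smul {F : ℂ → ℂ} (hF : IsAssociated μ L g₀ F) (c : ℂ) :
    IsAssociated μ L g₀ (c • F) where
  differentiable := hF.differentiable.const_smul c
  integrable := hF.integrable.smul c
  comm G hG w hw := by
    rw [weightedTransform_smul, Pi.smul_apply, smul_eq_mul]
    linear_combination c * hF.comm G hG w hw

lemma _root_.IsAssociated.sub {F G : ℂ → ℂ} (hF : IsAssociated μ L g₀ F)
    (hG : IsAssociated μ L g₀ G) : IsAssociated μ L g₀ (F - G) where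
  differentiable := hF.differentiable.sub hG.differentiable
  integrable := hF.integrable.sub hG.integrable
  comm K hK w hw := by
    rw [hL.weightedTransform_sub hF.integrable hG.integrable hw, Pi.sub_apply]
    linear_combination hF.comm K hK w hw - hG.comm K hK w hw

lemma exists_uniform_denominator {r : ℝ} (hr : 0 < r) {s : ℝ} (hs : |s| = 1) :
    ∃ κ B : ℝ, 0 < κ ∧ ∀ F, IsAssociated μ L g₀ F → ∫ x : ℝ, ‖F x‖ ∂μ ≤ 1 →
      ∃ D : ℂ → ℂ, DifferentiableOn ℂ D (sideHalf s) ∧ (∀ z ∈ sideHalf s, ‖D z‖ ≤ 1) ∧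
        (∀ z ∈ sideHalf s, z ∈ Metric.closedBall 0 (12 * r) → ‖F z * D z‖ ≤ B) ∧
        κ ≤ ‖D ((s * r : ℝ) * Complex.I)‖ := by
  have hw : (((s * r : ℝ) : ℂ) * Complex.I) ∈ sideHalf s := by
    have : 0 < s * s := by rw [← abs_mul_abs_self, hs]; norm_num
    have : 0 < s * (s * r) := by rw [← mul_assoc]; positivity
    simpa [sideHalf] using this
  set w := (((s * r : ℝ) : ℂ) * Complex.I) with hwdef
  have hwi := sideHalf_im_ne_zero hw
  have hwr : |w.im| = r := by simp [hwdef, abs_mul, hs, abs_of_pos hr]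
  obtain ⟨G, hG, hGw⟩ := hL.exists_weightedTransform_ne_zero hwi
  have hGi := hL.integrable_mul (hL.integrable G hG)
  obtain ⟨D₁, hd₁, h₁⟩ := exists_bounded_quotient_cauchyTransform hGi hs
  obtain ⟨B, hB⟩ := (isCompact_closedBall (0 : ℂ) (12 * r)).exists_bound_of_continuousOn
    (hL.differentiable G hG).continuous.continuousOn
  have hD₁ : 0 < ‖D₁ w‖ := by
    refine lt_of_lt_of_le ?_ (h₁ w hw).2.2
    positivity
  have hGw' := norm_pos_iff.2 hGw
  refine ⟨‖D₁ w‖ * ‖weightedTransform μ g₀ G w‖ * ((1 + 1 / r) ^ 4)⁻¹ / 8, B, by positivity,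
    fun F hF hF1 => ?_⟩
  have hFi := hL.integrable_mul hF.integrable
  obtain ⟨D₂, hd₂, h₂⟩ := exists_bounded_quotient_cauchyTransform hFi hs
  refine ⟨fun z => D₁ z * weightedTransform μ g₀ G z * D₂ z / 8, ?_, fun z hz => ?_,
    fun z hz hzr => ?_, ?_⟩
  · have : DifferentiableOn ℂ (weightedTransform μ g₀ G) (sideHalf s) := fun z hz =>
      (differentiableAt_cauchyTransform hGi (sideHalf_im_ne_zero hz)).differentiableWithinAt
    exact ((hd₁.mul this).mul hd₂).div_const _
  · rw [norm_div, norm_mul, RCLike.norm_ofNat, div_le_one (by norm_num)]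
    calc _ ≤ (8 : ℝ) * 1 := by
          gcongr
          · exact (h₁ z hz).2.1
          · exact (h₂ z hz).1
      _ = 8 := mul_one _
  · have e : F z * (D₁ z * weightedTransform μ g₀ G z * D₂ z / 8) =
        G z * (D₁ z * (D₂ z * weightedTransform μ g₀ F z)) / 8 := by
      linear_combination D₁ z * D₂ z / 8 * hF.comm G hG z (sideHalf_im_ne_zero hz)
    have hB0 := (norm_nonneg _).trans (hB z hzr)
    rw [e, norm_div, norm_mul, norm_mul, RCLike.norm_ofNat, div_le_iff₀ (by norm_num)]
    calc _ ≤ B * (1 * 8) := by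
          gcongr
          · exact hB z hzr
          · exact (h₁ z hz).1
          · exact (h₂ z hz).2.1
      _ = _ := by ring
  · rw [norm_div, norm_mul, norm_mul, RCLike.norm_ofNat]
    gcongr
    refine le_trans ?_ (h₂ w hw).2.2
    rw [hwr, hL.integral_norm_mul]
    gcongr

/-- Point evaluations of associated functions are locally uniformly bounded. -/
lemma exists_norm_le_mul_integral {R : ℝ} (hR : 0 < R) : ∃ C : ℝ, 0 ≤ C ∧
    ∀ F, IsAssociated μ L g₀ F → ∀ w ∈ Metric.closedBall (0 : ℂ) R,
      ‖F w‖ ≤ C * ∫ x : ℝ, ‖F x‖ ∂μ := by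
  obtain ⟨κ₁, B₁, hκ₁, h₁⟩ := hL.exists_uniform_denominator hR (s := 1) (by simp)
  obtain ⟨κ₂, B₂, hκ₂, h₂⟩ := hL.exists_uniform_denominator hR (s := -1) (by simp)
  set B := max 1 (max B₁ B₂)
  set κ := min κ₁ κ₂
  have hκ : 0 < κ := lt_min hκ₁ hκ₂
  set K := Real.log B + 512 * (8 * R) / R * Real.log (1 / κ)
  have hsphere : ∀ F, IsAssociated μ L g₀ F → ∫ x : ℝ, ‖F x‖ ∂μ ≤ 1 →
      ∀ z ∈ Metric.sphere (0 : ℂ) (8 * R), ‖F z‖ ≤ Real.exp K := by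
    intro F hF hF1 z hz
    rw [mem_sphere_zero_iff_norm] at hz
    have hball : Metric.ball z (‖z‖ / 2) ⊆ Metric.closedBall 0 (12 * R) := by
      intro v hv
      rw [Metric.mem_ball, dist_eq_norm] at hv
      rw [mem_closedBall_zero_iff]
      have := norm_sub_norm_le v z
      linarith
    have := posLog_norm_le_of_side_bounds hF.differentiable (z₀ := z) (r := R) (B := B) (κ := κ) hR
      hz.ge (le_max_left _ _) hκ (fun s hs => by
        rcases eq_or_eq_neg_of_abs_eq hs with rfl | rfl
        · obtain ⟨D, hd, hD1, hDB, hDκ⟩ := h₁ F hF hF1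
          exact ⟨D, hd, hD1, fun v hv hvb => (hDB v hv (hball hvb)).trans
            ((le_max_left _ _).trans (le_max_right _ _)), (min_le_left _ _).trans hDκ⟩
        · obtain ⟨D, hd, hD1, hDB, hDκ⟩ := h₂ F hF hF1
          exact ⟨D, hd, hD1, fun v hv hvb => (hDB v hv (hball hvb)).trans
            ((le_max_right _ _).trans (le_max_right _ _)), (min_le_right _ _).trans hDκ⟩)
    rw [hz] at this
    rcases eq_or_ne (F z) 0 with h0 | h0
    · rw [h0, norm_zero]; positivity
    · rw [← Real.log_le_iff_le_exp (norm_pos_iff.2 h0)]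
      exact (le_max_right _ _).trans this
  have hball : ∀ F, IsAssociated μ L g₀ F → ∫ x : ℝ, ‖F x‖ ∂μ ≤ 1 →
      ∀ z ∈ Metric.closedBall (0 : ℂ) R, ‖F z‖ ≤ Real.exp K := by
    intro F hF hF1 z hz
    refine Complex.norm_le_of_forall_mem_frontier_norm_le (U := Metric.ball (0 : ℂ) (8 * R))
      Metric.isBounded_ball hF.differentiable.diffContOnCl ?_ ?_
    · intro v hv
      rw [frontier_ball _ (by positivity)] at hv
      exact hsphere F hF hF1 v hv
    · refine subset_closure ?_
      rw [mem_closedBall_zero_iff] at hz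
      rw [mem_ball_zero_iff]
      linarith
  refine ⟨Real.exp K, (Real.exp_pos _).le, fun F hF w hw => ?_⟩
  refine le_of_forall_pos_le_add fun ε hε => ?_
  have hn : 0 ≤ ∫ x : ℝ, ‖F x‖ ∂μ := integral_nonneg fun _ => norm_nonneg _
  have hδ : 0 < ε / Real.exp K := by positivity
  set n := (∫ x : ℝ, ‖F x‖ ∂μ) + ε / Real.exp K
  have hnp : 0 < n := by positivity
  have hnn : ‖((n : ℂ)⁻¹)‖ = n⁻¹ := by simp [abs_of_pos hnp]
  have := hball _ (hF.smul (n : ℂ)⁻¹) (by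
    simp only [Pi.smul_apply, norm_smul, hnn]
    rw [integral_const_mul, inv_mul_le_iff₀ hnp, mul_one]
    exact le_add_of_nonneg_right hδ.le) w hw
  rw [Pi.smul_apply, norm_smul, hnn, inv_mul_le_iff₀ hnp] at this
  refine this.trans (le_of_eq ?_)
  have := Real.exp_pos K
  simp only [n]
  field_simp

lemma _root_.IsAssociated.eq_zero {F : ℂ → ℂ} (hF : IsAssociated μ L g₀ F)
    (h0 : ∫ x : ℝ, ‖F x‖ ∂μ = 0) : F = 0 := by
  ext w
  obtain ⟨C, -, hC⟩ := hL.exists_norm_le_mul_integral (R := ‖w‖ + 1) (by positivity)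
  have := hC F hF w (by simp)
  rw [h0, mul_zero] at this
  exact norm_le_zero_iff.1 this

end IsUnimodularKernel

lemma tendsto_lintegral_enorm_sub_zero {α : Type*} [MeasurableSpace α] {μ : Measure α}
    {u : ℕ → α → ℂ} {f : α → ℂ} (hm : ∀ k, AEStronglyMeasurable (u k) μ)
    (hlim : ∀ x, Tendsto (fun k => u k x) atTop (nhds (f x)))
    (hc : ∀ ε : ℝ, 0 < ε → ∃ N : ℕ, ∀ p ≥ N, ∀ q ≥ N,
      ∫⁻ x, ‖u p x - u q x‖ₑ ∂μ < ENNReal.ofReal ε) :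
    Tendsto (fun k => ∫⁻ x, ‖u k x - f x‖ₑ ∂μ) atTop (nhds 0) := by
  have key : ∀ ε : ℝ, 0 < ε → ∃ N : ℕ, ∀ p ≥ N,
      ∫⁻ x, ‖u p x - f x‖ₑ ∂μ ≤ ENNReal.ofReal ε := by
    intro ε hε
    obtain ⟨N, hN⟩ := hc ε hε
    refine ⟨N, fun p hp => ?_⟩
    have h1 : ∀ x, ‖u p x - f x‖ₑ = liminf (fun q => ‖u p x - u q x‖ₑ) atTop := fun x =>
      (((tendsto_const_nhds.sub (hlim x)).enorm).liminf_eq).symm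
    simp only [h1]
    refine (lintegral_liminf_le' fun q => ((hm p).sub (hm q)).enorm).trans ?_
    refine liminf_le_of_frequently_le' (Eventually.frequently ?_)
    filter_upwards [eventually_ge_atTop N] with q hq
    exact (hN p hp q hq).le
  rw [ENNReal.tendsto_atTop_zero]
  intro ε hε
  rcases eq_or_ne ε ⊤ with rfl | hε'
  · exact ⟨0, fun _ _ => le_top⟩
  · obtain ⟨N, hN⟩ := key ε.toReal (ENNReal.toReal_pos hε.ne' hε')
    exact ⟨N, fun p hp => (hN p hp).trans_eq (ENNReal.ofReal_toReal hε')⟩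

namespace IsUnimodularKernel

variable {μ : Measure ℝ} {L : Submodule ℂ (ℂ → ℂ)} {g₀ : ℝ → ℂ} (hL : IsUnimodularKernel μ L g₀)
include hL

lemma bddTypeQuot {F F₀ : ℂ → ℂ} (hF : IsAssociated μ L g₀ F) (hF₀ : F₀ ∈ L) (hF₀0 : F₀ ≠ 0)
    {s : ℝ} (hs : |s| = 1) : BddTypeQuot (sideHalf s) F F₀ := by
  have hFi := hL.integrable_mul hF.integrable
  have hF₀i := hL.integrable_mul (hL.integrable F₀ hF₀)
  obtain ⟨D₁, hd₁, h₁⟩ := exists_bounded_quotient_cauchyTransform hFi hs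
  obtain ⟨D₂, hd₂, h₂⟩ := exists_bounded_quotient_cauchyTransform hF₀i hs
  have hd : ∀ h : ℝ → ℂ, Integrable h μ → DifferentiableOn ℂ (cauchyTransform μ h) (sideHalf s) :=
    fun h hh z hz =>
      (differentiableAt_cauchyTransform hh (sideHalf_im_ne_zero hz)).differentiableWithinAt
  have hsI : (s : ℂ) * Complex.I ∈ sideHalf s := by
    have : 0 < s * s := by rw [← abs_mul_abs_self, hs]; norm_num
    simpa [sideHalf] using this
  refine ⟨fun z => (D₁ z * weightedTransform μ g₀ F z) * D₂ z,
    fun z => (D₂ z * weightedTransform μ g₀ F₀ z) * D₁ z, (hd₁.mul (hd _ hFi)).mul hd₂,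
    (hd₂.mul (hd _ hF₀i)).mul hd₁, ⟨8 * 1, fun z hz => ?_⟩, ⟨8 * 1, fun z hz => ?_⟩, ?_,
    fun z hz => ?_⟩
  · rw [norm_mul]
    exact mul_le_mul (h₁ z hz).2.1 (h₂ z hz).1 (norm_nonneg _) (by norm_num)
  · rw [norm_mul]
    exact mul_le_mul (h₂ z hz).2.1 (h₁ z hz).1 (norm_nonneg _) (by norm_num)
  · intro hcon
    obtain ⟨z, hz0, hz⟩ := (dense_ne_zero_of_differentiable (hL.differentiable F₀ hF₀) hF₀0
      ).inter_nhds_nonempty ((isOpen_sideHalf s).mem_nhds hsI)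
    have hzi := sideHalf_im_ne_zero hz
    obtain ⟨G, hG, hGz⟩ := hL.exists_weightedTransform_ne_zero hzi
    have h3 : ∀ (D : ℂ → ℂ) (h : ℝ → ℂ),
        ((1 + (∫ x, ‖h x‖ ∂μ) / |z.im|) ^ 4)⁻¹ ≤ ‖D z‖ → D z ≠ 0 := by
      intro D h hle
      rw [← norm_pos_iff]
      refine lt_of_lt_of_le ?_ hle
      positivity
    have hF₀z : weightedTransform μ g₀ F₀ z ≠ 0 := by
      intro h
      have := hL.mul_weightedTransform_comm hF₀ hG hzi
      rw [h, mul_zero] at this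
      exact mul_ne_zero hz0 hGz this
    exact mul_ne_zero (mul_ne_zero (h3 _ _ (h₂ z hz).2.2) hF₀z) (h3 _ _ (h₁ z hz).2.2) (hcon z hz)
  · linear_combination D₁ z * D₂ z * hF.comm F₀ hF₀ z (sideHalf_im_ne_zero hz)

lemma enorm_le_mul_L1Majorant_of_mem {F : ℂ → ℂ} (hF : F ∈ L) {N : ℝ≥0} (hN : 0 < N)
    (hFN : ∫ x : ℝ, ‖F x‖ ∂μ ≤ N) (w : ℂ) : ‖F w‖ₑ ≤ N * L1Majorant μ L w := by
  have hN0 : (0 : ℝ) < N := hN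
  have hNn : ‖((N : ℝ) : ℂ)‖ = N := by rw [Complex.norm_real, Real.norm_of_nonneg hN0.le]
  have hNe : ‖((N : ℝ) : ℂ)‖ₑ = N := by rw [← ofReal_norm, hNn, ENNReal.ofReal_coe_nnreal]
  have hFi : Integrable (fun x : ℝ => ((((N : ℝ) : ℂ)⁻¹) • F) x) μ := (hL.integrable F hF).smul _
  have h1 : ∫⁻ x : ℝ, ‖((((N : ℝ) : ℂ)⁻¹) • F) (x : ℂ)‖ₑ ∂μ ≤ 1 := by
    rw [← ofReal_integral_norm_eq_lintegral_enorm hFi, ← ENNReal.ofReal_one]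
    refine ENNReal.ofReal_le_ofReal ?_
    simp only [Pi.smul_apply, norm_smul, norm_inv, hNn]
    rwa [integral_const_mul, inv_mul_le_iff₀ hN0, mul_one]
  have h2 : ‖((((N : ℝ) : ℂ)⁻¹) • F) w‖ₑ ≤ L1Majorant μ L w :=
    le_iSup (fun F : {F : ℂ → ℂ // F ∈ L ∧ (∫⁻ x : ℝ, (‖F (x : ℂ)‖₊ : ℝ≥0∞) ∂μ) ≤ 1} =>
      (‖F.1 w‖₊ : ℝ≥0∞)) ⟨_, L.smul_mem _ hF, h1⟩
  have e : F w = ((N : ℝ) : ℂ) * ((((N : ℝ) : ℂ)⁻¹) • F) w := by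
    have : ((N : ℝ) : ℂ) ≠ 0 := by exact_mod_cast hN0.ne'
    rw [Pi.smul_apply, smul_eq_mul, mul_inv_cancel_left₀ this]
  rw [e, enorm_mul, hNe]
  exact mul_le_mul_right h2 _

lemma enorm_le_mul_L1Majorant {f : ℂ → ℂ} (hf : IsAssociated μ L g₀ f)
    (h0 : ∫ x : ℝ, f x * g₀ x ∂μ = 0) : ∃ N : ℝ≥0, ∀ w, ‖f w‖ₑ ≤ N * L1Majorant μ L w := by
  have hn : 0 ≤ ∫ x : ℝ, ‖f x‖ ∂μ := integral_nonneg fun _ => norm_nonneg _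
  refine ⟨Real.toNNReal ((∫ x : ℝ, ‖f x‖ ∂μ) + 1), fun w => ?_⟩
  have hN : 0 < (∫ x : ℝ, ‖f x‖ ∂μ) + 1 := by positivity
  choose H hH hHn using fun n : ℕ =>
    hL.exists_approx (fun x => f x) hf.integrable h0 (1 / ((n : ℝ) + 1)) (by positivity)
  obtain ⟨C, hC0, hC⟩ := hL.exists_norm_le_mul_integral (R := ‖w‖ + 1) (by positivity)
  have hlim : Tendsto (fun n => H n w) atTop (nhds (f w)) := by
    rw [tendsto_iff_norm_sub_tendsto_zero]
    refine squeeze_zero (g := fun n : ℕ => C * (1 / ((n : ℝ) + 1))) (fun _ => norm_nonneg _)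
      (fun n => ?_) ?_
    · have := hC _ (IsAssociated.sub hL hf (hL.isAssociated_of_mem (hH n))) w (by simp)
      rw [norm_sub_rev]
      exact this.trans (mul_le_mul_of_nonneg_left (hHn n).le hC0)
    · simpa using tendsto_one_div_add_atTop_nhds_zero_nat.const_mul C
  refine le_of_tendsto hlim.enorm (Eventually.of_forall fun n => ?_)
  refine hL.enorm_le_mul_L1Majorant_of_mem (hH n) (Real.toNNReal_pos.2 hN) ?_ w
  rw [Real.coe_toNNReal _ hN.le]
  have hHi := hL.integrable _ (hH n)
  calc ∫ x : ℝ, ‖H n x‖ ∂μ ≤ ∫ x : ℝ, (‖f x‖ + ‖f x - H n x‖) ∂μ := by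
        refine integral_mono hHi.norm (hf.integrable.norm.add (hf.integrable.sub hHi).norm)
          fun x => ?_
        have := norm_sub_norm_le (H n x) (f x)
        rw [norm_sub_rev] at this
        show ‖H n x‖ ≤ ‖f x‖ + ‖f x - H n x‖
        linarith
    _ = (∫ x : ℝ, ‖f x‖ ∂μ) + ∫ x : ℝ, ‖f x - H n x‖ ∂μ :=
        integral_add hf.integrable.norm (hf.integrable.sub hHi).norm
    _ ≤ _ := by
        gcongr
        refine (hHn n).le.trans ?_
        rw [div_le_one (by positivity)]
        linarith [(Nat.cast_nonneg n : (0 : ℝ) ≤ n)]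

lemma memKcal_of_isAssociated {F u : ℂ → ℂ} (hF : IsAssociated μ L g₀ F) (hu : MemKcal μ L u)
    {c : ℂ} (hc : ∫ x : ℝ, F x * g₀ x ∂μ = c * ∫ x : ℝ, u x * g₀ x ∂μ) : MemKcal μ L F := by
  have hua := hL.isAssociated_of_memKcal hu
  obtain ⟨N, hN⟩ := hL.enorm_le_mul_L1Majorant (IsAssociated.sub hL hF (hua.smul c)) (by
    simp only [Pi.sub_apply, Pi.smul_apply, smul_eq_mul, sub_mul, mul_assoc]
    rw [integral_sub (hL.integrable_mul hF.integrable)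
      ((hL.integrable_mul hua.integrable).const_mul c), integral_const_mul, hc, sub_self])
  obtain ⟨-, -, ⟨C, hC⟩, F₀, hF₀, hF₀0, -, -⟩ := hu
  refine ⟨hF.differentiable, hF.integrable.2, ⟨N + ‖c‖₊ * C, ?_⟩, F₀, hF₀, hF₀0, ?_, ?_⟩
  · filter_upwards [hC] with y hy
    set w := (y : ℂ) * Complex.I
    have e : F w = (F - c • u) w + c * u w := by simp
    show ‖F w‖ₑ ≤ _
    rw [e, ENNReal.coe_add, ENNReal.coe_mul, add_mul, mul_assoc]
    refine (enorm_add_le _ _).trans (add_le_add (hN w) ?_)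
    rw [enorm_mul]
    exact mul_le_mul_right hy _
  · rw [upperHalf_eq]
    exact hL.bddTypeQuot hF hF₀ hF₀0 (by simp)
  · rw [lowerHalf_eq]
    exact hL.bddTypeQuot hF hF₀ hF₀0 (by simp)

lemma exists_limit {u : ℕ → ℂ → ℂ} (hu : ∀ k, MemKcal μ L (u k))
    (hc : ∀ ε : ℝ, 0 < ε → ∃ N : ℕ, ∀ p ≥ N, ∀ q ≥ N,
      ∫⁻ x : ℝ, ‖u p x - u q x‖ₑ ∂μ < ENNReal.ofReal ε) :
    ∃ F, MemKcal μ L F ∧ Tendsto (fun k => ∫⁻ x : ℝ, ‖u k x - F x‖ₑ ∂μ) atTop (nhds 0) := by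
  have hua := fun k => hL.isAssociated_of_memKcal (hu k)
  have hcauchy : ∀ R : ℝ, 0 < R → ∀ ε : ℝ, 0 < ε → ∃ N : ℕ, ∀ p ≥ N, ∀ q ≥ N,
      ∀ w ∈ Metric.closedBall (0 : ℂ) R, ‖u p w - u q w‖ < ε := by
    intro R hR ε hε
    obtain ⟨C, hC0, hC⟩ := hL.exists_norm_le_mul_integral hR
    obtain ⟨N, hN⟩ := hc (ε / (C + 1)) (by positivity)
    refine ⟨N, fun p hp q hq w hw => ?_⟩
    have h1 := hC _ (IsAssociated.sub hL (hua p) (hua q)) w hw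
    have h2 : ∫ x : ℝ, ‖(u p - u q) x‖ ∂μ < ε / (C + 1) := by
      have := hN p hp q hq
      have hi : Integrable (fun x : ℝ => u p x - u q x) μ :=
        (hua p).integrable.sub (hua q).integrable
      rw [← ofReal_integral_norm_eq_lintegral_enorm hi] at this
      exact (ENNReal.ofReal_lt_ofReal_iff (by positivity)).1 this
    rw [lt_div_iff₀ (by positivity)] at h2
    have h3 : 0 ≤ ∫ x : ℝ, ‖(u p - u q) x‖ ∂μ := integral_nonneg fun _ => norm_nonneg _
    refine h1.trans_lt ?_
    linarith
  have hptw : ∀ w, ∃ a, Tendsto (fun k => u k w) atTop (nhds a) := by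
    intro w
    refine cauchySeq_tendsto_of_complete (Metric.cauchySeq_iff.2 fun ε hε => ?_)
    obtain ⟨N, hN⟩ := hcauchy (‖w‖ + 1) (by positivity) ε hε
    refine ⟨N, fun p hp q hq => ?_⟩
    rw [dist_eq_norm]
    exact hN p hp q hq w (by simp)
  choose F hF using hptw
  have hunif : TendstoLocallyUniformlyOn u F atTop Set.univ := by
    rw [Metric.tendstoLocallyUniformlyOn_iff]
    intro ε hε w _
    obtain ⟨N, hN⟩ := hcauchy (‖w‖ + 1) (by positivity) (ε / 2) (by positivity)
    refine ⟨Metric.ball w 1, mem_nhdsWithin_of_mem_nhds (Metric.ball_mem_nhds w one_pos), ?_⟩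
    filter_upwards [eventually_ge_atTop N] with p hp v hv
    have hv' : v ∈ Metric.closedBall (0 : ℂ) (‖w‖ + 1) := by
      rw [Metric.mem_ball, dist_eq_norm] at hv
      rw [mem_closedBall_zero_iff]
      have := norm_sub_norm_le v w
      linarith
    rw [dist_eq_norm]
    have : ‖F v - u p v‖ ≤ ε / 2 := by
      refine le_of_tendsto ((hF v).sub_const (u p v)).norm ?_
      filter_upwards [eventually_ge_atTop N] with q hq
      exact (hN q hq p hp v hv').le
    linarith
  have hFd : Differentiable ℂ F := by
    rw [← differentiableOn_univ]
    exact hunif.differentiableOn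
      (Eventually.of_forall fun k => (hua k).differentiable.differentiableOn) isOpen_univ
  have hFm : AEStronglyMeasurable (fun x : ℝ => F x) μ :=
    (hFd.continuous.comp Complex.continuous_ofReal).aestronglyMeasurable
  have hlim := tendsto_lintegral_enorm_sub_zero (fun k => (hua k).integrable.aestronglyMeasurable)
    (fun x : ℝ => hF x) hc
  obtain ⟨N, hN⟩ := (hlim.eventually (gt_mem_nhds one_pos)).exists
  have hFi : Integrable (fun x : ℝ => F x) μ := by
    have h1 : Integrable (fun x : ℝ => u N x - F x) μ :=
      ⟨(hua N).integrable.aestronglyMeasurable.sub hFm, hN.trans ENNReal.one_lt_top⟩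
    refine ((hua N).integrable.sub h1).congr (Eventually.of_forall fun x => ?_)
    simp
  have hlim' : Tendsto (fun k => ∫ x : ℝ, ‖u k x - F x‖ ∂μ) atTop (nhds 0) := by
    have := (ENNReal.tendsto_toReal ENNReal.zero_ne_top).comp hlim
    refine this.congr fun k => ?_
    exact (integral_norm_eq_lintegral_enorm
      ((hua k).integrable.sub hFi).aestronglyMeasurable).symm
  have hFa : IsAssociated μ L g₀ F := by
    refine ⟨hFd, hFi, fun G hG w hw => ?_⟩
    have h1 : Tendsto (fun k => weightedTransform μ g₀ (u k) w) atTop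
        (nhds (weightedTransform μ g₀ F w)) := by
      rw [tendsto_iff_norm_sub_tendsto_zero]
      refine squeeze_zero (fun _ => norm_nonneg _) (fun k => ?_)
        (by simpa using hlim'.div_const |w.im|)
      rw [← hL.weightedTransform_sub (hua k).integrable hFi hw]
      exact hL.norm_weightedTransform_le ((hua k).integrable.sub hFi) hw
    refine tendsto_nhds_unique ((hF w).mul_const _) ?_
    refine (h1.const_mul (G w)).congr fun k => ?_
    exact ((hua k).comm G hG w hw).symm
  have hex : ∃ (k : ℕ) (c : ℂ), ∫ x : ℝ, F x * g₀ x ∂μ = c * ∫ x : ℝ, u k x * g₀ x ∂μ := by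
    rcases eq_or_ne (∫ x : ℝ, F x * g₀ x ∂μ) 0 with h0 | h0
    · exact ⟨0, 0, by rw [h0, zero_mul]⟩
    have h1 : Tendsto (fun k => ∫ x : ℝ, u k x * g₀ x ∂μ) atTop
        (nhds (∫ x : ℝ, F x * g₀ x ∂μ)) := by
      rw [tendsto_iff_norm_sub_tendsto_zero]
      refine squeeze_zero (fun _ => norm_nonneg _) (fun k => ?_) hlim'
      rw [← integral_sub (hL.integrable_mul (hua k).integrable) (hL.integrable_mul hFi),
        ← hL.integral_norm_mul]
      simp only [← sub_mul]
      exact norm_integral_le_integral_norm _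
    obtain ⟨k, hk⟩ := (h1.eventually_ne h0).exists
    exact ⟨k, _, (div_mul_cancel₀ _ hk).symm⟩
  obtain ⟨k, c, hkc⟩ := hex
  exact ⟨F, hL.memKcal_of_isAssociated hFa (hu k) hkc, hlim⟩

end IsUnimodularKernel

lemma IsDiscreteMeasure.exists_atom {μ : Measure ℝ} [IsLocallyFiniteMeasure μ]
    (hμ : IsDiscreteMeasure μ) {U : Set ℝ} (hU : μ U ≠ 0) : ∃ x ∈ U, 0 < μ.real {x} := by
  obtain ⟨s, hs, hsμ⟩ := hμ
  obtain ⟨x, hx, hx0⟩ : ∃ x ∈ U ∩ s, μ {x} ≠ 0 := by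
    by_contra! hcon
    have h1 : μ (⋃ x ∈ U ∩ s, {x}) = 0 :=
      (measure_biUnion_null_iff (hs.mono Set.inter_subset_right)).2 hcon
    rw [Set.biUnion_of_singleton] at h1
    refine hU (measure_mono_null (t := (U ∩ s) ∪ sᶜ) ?_ (measure_union_null h1 hsμ))
    intro x hx
    by_cases hxs : x ∈ s
    · exact Or.inl ⟨hx, hxs⟩
    · exact Or.inr hxs
  exact ⟨x, hx.1, ENNReal.toReal_pos hx0 isCompact_singleton.measure_lt_top.ne⟩

/-- `‖F‖_𝒦 := ‖F|_ℝ‖_{L¹(μ)}` is a norm on `𝒦` (definiteness; homogeneity and the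
triangle inequality hold automatically), `𝒦` is complete for this norm, and all
point evaluations are continuous on `𝒦`. -/
theorem stmt16 (μ : MeasureTheory.Measure ℝ) [MeasureTheory.IsLocallyFiniteMeasure μ]
    (hdisc : IsDiscreteMeasure μ)
    (hsupp : ∃ a b : ℝ, a ≠ b ∧ MemSupport μ a ∧ MemSupport μ b)
    (L : Submodule ℂ (ℂ → ℂ)) (hdb : IsAlgebraicDeBranges L)
    (hint : ∀ F ∈ L, (∫⁻ x : ℝ, (‖F (x : ℂ)‖₊ : ℝ≥0∞) ∂μ) < ⊤)
    (hinj : ∀ F ∈ L, ∀ G ∈ L, (fun x : ℝ => F (x : ℂ)) =ᵐ[μ] (fun x : ℝ => G (x : ℂ)) → F = G)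
    (g₀ : ℝ → ℂ) (hg₀m : Measurable g₀) (hg₀u : ∀ᵐ x ∂μ, ‖g₀ x‖ = 1)
    (hclos : ∀ f : ℝ → ℂ, MeasureTheory.Integrable f μ →
      ((∀ ε : ℝ, 0 < ε → ∃ F ∈ L,
          (∫⁻ x : ℝ, (‖f x - F (x : ℂ)‖₊ : ℝ≥0∞) ∂μ) < ENNReal.ofReal ε) ↔
        ∫ x, f x * g₀ x ∂μ = 0)) :
    -- `‖·‖_𝒦` is a norm: definiteness on `𝒦`
    (∀ F : ℂ → ℂ, MemKcal μ L F → ((∫⁻ x : ℝ, (‖F (x : ℂ)‖₊ : ℝ≥0∞) ∂μ) = 0 ↔ F = 0)) ∧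
    -- completeness: every `‖·‖_𝒦`-Cauchy sequence in `𝒦` converges in `𝒦`
    (∀ u : ℕ → ℂ → ℂ, (∀ k, MemKcal μ L (u k)) →
      (∀ ε : ℝ, 0 < ε → ∃ N : ℕ, ∀ p ≥ N, ∀ q ≥ N,
        (∫⁻ x : ℝ, (‖u p (x : ℂ) - u q (x : ℂ)‖₊ : ℝ≥0∞) ∂μ) < ENNReal.ofReal ε) →
      ∃ F : ℂ → ℂ, MemKcal μ L F ∧
        Filter.Tendsto (fun k => ∫⁻ x : ℝ, (‖u k (x : ℂ) - F (x : ℂ)‖₊ : ℝ≥0∞) ∂μ)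
          atTop (nhds 0)) ∧
    -- continuity of the point evaluations
    (∀ w : ℂ, ∃ C : ℝ≥0, ∀ F : ℂ → ℂ, MemKcal μ L F →
      (‖F w‖₊ : ℝ≥0∞) ≤ C * ∫⁻ x : ℝ, (‖F (x : ℂ)‖₊ : ℝ≥0∞) ∂μ) := by
  have hLi : ∀ F ∈ L, Integrable (fun x : ℝ => F x) μ := fun F hF =>
    integrable_of_lintegral_lt_top (hdb.1 F hF) (hint F hF)
  have hL : IsUnimodularKernel μ L g₀ :=
    { differentiable := hdb.1
      exists_div := hdb.2.1
      integrable := hLi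
      measurable := hg₀m
      norm_eq_one := hg₀u
      integral_eq_zero := fun F hF => (hclos _ (hLi F hF)).1 fun ε hε => ⟨F, hF, by simpa using hε⟩
      exists_approx := by
        intro f hf h0 ε hε
        obtain ⟨F, hF, hFε⟩ := (hclos f hf).2 h0 ε hε
        have hi : Integrable (fun x : ℝ => f x - F x) μ := hf.sub (hLi F hF)
        refine ⟨F, hF, (ENNReal.ofReal_lt_ofReal_iff hε).1 ?_⟩
        rw [ofReal_integral_norm_eq_lintegral_enorm hi]
        exact hFε
      exists_atoms := by
        obtain ⟨a, b, hab, ha, hb⟩ := hsupp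
        obtain ⟨U, V, hU, hV, haU, hbV, hUV⟩ := t2_separation hab
        obtain ⟨x, hxU, hx⟩ := hdisc.exists_atom (ha U (hU.mem_nhds haU))
        obtain ⟨y, hyV, hy⟩ := hdisc.exists_atom (hb V (hV.mem_nhds hbV))
        exact ⟨x, y, fun h => Set.disjoint_left.1 hUV hxU (h ▸ hyV), hx, hy⟩ }
  refine ⟨fun F hF => ⟨fun h => ?_, fun h => by simp [h]⟩, fun u hu hc => hL.exists_limit hu hc,
    fun w => ?_⟩
  · have hFa := hL.isAssociated_of_memKcal hF
    refine IsAssociated.eq_zero hL hFa ?_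
    rw [integral_norm_eq_lintegral_enorm hFa.integrable.aestronglyMeasurable]
    exact (congrArg ENNReal.toReal h).trans ENNReal.toReal_zero
  · obtain ⟨C, hC0, hC⟩ := hL.exists_norm_le_mul_integral (R := ‖w‖ + 1) (by positivity)
    refine ⟨C.toNNReal, fun F hF => ?_⟩
    have hFa := hL.isAssociated_of_memKcal hF
    have h1 := ENNReal.ofReal_le_ofReal (hC F hFa w (by simp))
    rw [ofReal_norm, ENNReal.ofReal_mul hC0,
      ofReal_integral_norm_eq_lintegral_enorm hFa.integrable] at h1
    exact h1
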